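/- Let A be a ℂ-algebra with a rational action of a connected reductive group G by automorphisms, compatible with a G-equivariant algebra map U(g) → A (a generalized pair), so that the adjoint g-action on A is locally finite and completely reducible. Let V be an A-module. Then for each k, the rank-filtration subspace R_k(V) = {v ∈ V : dim V(Ann_{Z(g)}(v)) ≤ k} is an A-submodule of V. Consequently, if V is an irreducible A-module, then V is equi-rank: dim V(Ann_{Z(g)}(v)) is the same for all nonzero v ∈ V. -/

import Mathlib

set_option synthInstance.maxHeartbeats 1000000
set_option maxHeartbeats 2000000

open UniversalEnvelopingAlgebra

/-- The annihilator in the center `Z(g)` of `U(g)` of a vector `v` of an `A`-module,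
where `A` receives an algebra map `ι : U(g) → A` (a generalized pair). -/
noncomputable def centerAnnVec
    (L : Type*) [LieRing L] [LieAlgebra ℂ L]
    (A : Type*) [Ring A] [Algebra ℂ A] (ι : UniversalEnvelopingAlgebra ℂ L →ₐ[ℂ] A)
    (V : Type*) [AddCommGroup V] [Module A V] (v : V) :
    Ideal (Subring.center (UniversalEnvelopingAlgebra ℂ L)) where
  carrier := {z | ι (z : UniversalEnvelopingAlgebra ℂ L) • v = 0}
  zero_mem' := by simp
  add_mem' := by
    intro a b ha hb
    rw [Set.mem_setOf_eq] at *
    rw [Subring.coe_add, map_add, add_smul, ha, hb, add_zero]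
  smul_mem' := by
    intro c z hz
    rw [Set.mem_setOf_eq] at *
    rw [smul_eq_mul, Subring.coe_mul, map_mul, mul_smul, hz, smul_zero]

theorem ringKrullDim_le_of_isIntegral {R S : Type*} [CommRing R] [CommRing S] (f : R →+* S)
    (hf : f.IsIntegral) : ringKrullDim S ≤ ringKrullDim R := by
  algebraize [f]
  refine Order.krullDim_le_of_strictMono (PrimeSpectrum.comap f) fun P Q h => ?_
  exact Ideal.IsIntegral.comap_lt_comap h

theorem ringKrullDim_le_of_isIntegral_of_injective {R S : Type*} [CommRing R] [CommRing S]
    (f : R →+* S) (hf : f.IsIntegral) (hinj : Function.Injective f) :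
    ringKrullDim R ≤ ringKrullDim S := by
  algebraize [f]
  refine iSup_le fun l => ?_
  have : FaithfulSMul R S := (faithfulSMul_iff_algebraMap_injective R S).2 hinj
  obtain ⟨Q, hQ, hQ'⟩ := Ideal.exists_ideal_over_prime_of_isIntegral (S := S) l.head.asIdeal ⊥ (by
    rw [← RingHom.ker_eq_comap_bot,
      (RingHom.injective_iff_ker_eq_bot (algebraMap R S)).1 hinj]
    exact bot_le)
  have := hQ'.1
  have : Q.LiesOver l.head.asIdeal := ⟨hQ'.2.symm⟩
  obtain ⟨L, hL, -⟩ := Ideal.exists_ltSeries_of_hasGoingUp (S := S) l Q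
  rw [← hL]
  exact le_iSup (fun p : LTSeries (PrimeSpectrum S) => (p.length : WithBot ℕ∞)) L

theorem ringKrullDim_quotient_le_of_le {R : Type*} [CommRing R] {I J : Ideal R} (h : I ≤ J) :
    ringKrullDim (R ⧸ J) ≤ ringKrullDim (R ⧸ I) :=
  ringKrullDim_le_of_surjective _ (Ideal.Quotient.factor_surjective h)

theorem ringKrullDim_quotient_inf_le {R : Type*} [CommRing R] {I J : Ideal R} {k : WithBot ℕ∞}
    (hI : ringKrullDim (R ⧸ I) ≤ k) (hJ : ringKrullDim (R ⧸ J) ≤ k) :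
    ringKrullDim (R ⧸ (I ⊓ J)) ≤ k := by
  have key (K : Ideal R) (l : LTSeries (PrimeSpectrum.zeroLocus (R := R) ↑(I ⊓ J)))
      (h : K ≤ l.head.1.asIdeal) : (l.length : WithBot ℕ∞) ≤ ringKrullDim (R ⧸ K) := by
    rw [ringKrullDim_quotient]
    let l' : LTSeries (PrimeSpectrum.zeroLocus (R := R) K) :=
      { length := l.length
        toFun := fun i => ⟨(l i).1, h.trans (LTSeries.head_le l i)⟩
        step := fun i => l.step i }
    exact le_iSup (fun p : LTSeries (PrimeSpectrum.zeroLocus (R := R) K) =>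
      (p.length : WithBot ℕ∞)) l'
  rw [ringKrullDim_quotient]
  refine iSup_le fun l => ?_
  have h0 : I ⊓ J ≤ l.head.1.asIdeal := l.head.2
  rcases (l.head.1.2.inf_le).1 h0 with h | h
  · exact (key I l h).trans hI
  · exact (key J l h).trans hJ


section Noetherian

variable {k U : Type*} [Field k] [Ring U] [Algebra k U] {m : ℕ}

/-- The span of the words of length less than `n` in the elements `s i`. -/
def wordSpan (k : Type*) {U : Type*} [Field k] [Ring U] [Algebra k U] {m : ℕ} (s : Fin m → U)
    (n : ℕ) : Submodule k U :=
  Submodule.span k {u | ∃ l : List (Fin m), l.length < n ∧ (l.map s).prod = u}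

theorem wordSpan_mono (s : Fin m → U) : Monotone (wordSpan k s) := fun _ _ h =>
  Submodule.span_mono fun _ ⟨l, hl, hu⟩ => ⟨l, hl.trans_le h, hu⟩

theorem prod_mem_wordSpan (s : Fin m → U) (l : List (Fin m)) {n : ℕ} (h : l.length < n) :
    (l.map s).prod ∈ wordSpan k s n :=
  Submodule.subset_span ⟨l, h, rfl⟩

theorem mul_mem_wordSpan (s : Fin m → U) (i : Fin m) {n : ℕ} {u : U} (hu : u ∈ wordSpan k s n) :
    s i * u ∈ wordSpan k s (n + 1) := by
  induction hu using Submodule.span_induction with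
  | mem u hu =>
    obtain ⟨l, hl, rfl⟩ := hu
    simpa using prod_mem_wordSpan (k := k) s (i :: l) (n := n + 1) (by simpa using hl)
  | zero => simp
  | add u v _ _ hu hv => rw [mul_add]; exact add_mem hu hv
  | smul c u _ hu => rw [mul_smul_comm]; exact Submodule.smul_mem _ _ hu

theorem exists_mem_wordSpan (s : Fin m → U) (hs : Algebra.adjoin k (Set.range s) = ⊤) (u : U) :
    ∃ n, u ∈ wordSpan k s n := by
  have hmul : ∀ u : U, ∀ n, ∀ w ∈ wordSpan k s n, ∃ n', u * w ∈ wordSpan k s n' := by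
    intro u
    have hu : u ∈ Algebra.adjoin k (Set.range s) := hs ▸ Algebra.mem_top
    induction hu using Algebra.adjoin_induction with
    | mem u hu =>
      obtain ⟨i, rfl⟩ := hu
      exact fun n w hw => ⟨_, mul_mem_wordSpan s i hw⟩
    | algebraMap r =>
      intro n w hw
      exact ⟨n, by rw [← Algebra.smul_def]; exact Submodule.smul_mem _ _ hw⟩
    | add u v _ _ hu hv =>
      intro n w hw
      obtain ⟨a, ha⟩ := hu n w hw
      obtain ⟨b, hb⟩ := hv n w hw
      exact ⟨max a b, by
        rw [add_mul]
        exact add_mem (wordSpan_mono s (le_max_left a b) ha)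
          (wordSpan_mono s (le_max_right a b) hb)⟩
    | mul u v _ _ hu hv =>
      intro n w hw
      obtain ⟨a, ha⟩ := hv n w hw
      rw [mul_assoc]
      exact hu a _ ha
  obtain ⟨n, hn⟩ := hmul u 1 1 (prod_mem_wordSpan s [] one_pos)
  exact ⟨n, by simpa using hn⟩

theorem prod_sub_prod_mem_wordSpan (s : Fin m → U)
    (hc : ∀ i j, s i * s j - s j * s i ∈ Submodule.span k (Set.range s))
    {l l' : List (Fin m)} (h : l.Perm l') :
    (l.map s).prod - (l'.map s).prod ∈ wordSpan k s l.length := by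
  induction h with
  | nil => simp
  | cons x _ ih =>
    simp only [List.map_cons, List.prod_cons, ← mul_sub, List.length_cons]
    exact mul_mem_wordSpan s x ih
  | swap x y l =>
    simp only [List.map_cons, List.prod_cons, ← mul_assoc, ← sub_mul, List.length_cons]
    have hv := hc y x
    generalize s y * s x - s x * s y = v at hv ⊢
    induction hv using Submodule.span_induction with
    | mem u hu =>
      obtain ⟨i, rfl⟩ := hu
      exact mul_mem_wordSpan s i (prod_mem_wordSpan s l (Nat.lt_succ_self _))
    | zero => simp
    | add u v _ _ hu hv => rw [add_mul]; exact add_mem hu hv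
    | smul c u _ hu => rw [smul_mul_assoc]; exact Submodule.smul_mem _ _ hu
  | trans h₁ _ ih₁ ih₂ =>
    rw [← h₁.length_eq] at ih₂
    simpa using add_mem ih₁ ih₂

/-- The product of the elements `s i` with multiplicities given by `d`, in an arbitrary order. -/
noncomputable def monomialWord (s : Fin m → U) (d : Fin m →₀ ℕ) : U :=
  ((Finsupp.toMultiset d).toList.map s).prod

theorem length_toList_toMultiset (d : Fin m →₀ ℕ) :
    (Finsupp.toMultiset d).toList.length = d.degree := by
  rw [Multiset.length_toList, Finsupp.card_toMultiset, Finsupp.degree_apply]; rfl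

theorem monomialWord_single_add (s : Fin m → U)
    (hc : ∀ i j, s i * s j - s j * s i ∈ Submodule.span k (Set.range s))
    (i : Fin m) (d : Fin m →₀ ℕ) :
    s i * monomialWord s d - monomialWord s (Finsupp.single i 1 + d) ∈
      wordSpan k s (d.degree + 1) := by
  have h : (i :: (Finsupp.toMultiset d).toList).Perm
      (Finsupp.toMultiset (Finsupp.single i 1 + d)).toList := by
    rw [← Multiset.coe_eq_coe, Multiset.coe_toList, ← Multiset.cons_coe, Multiset.coe_toList]
    simp
  have := prod_sub_prod_mem_wordSpan s hc h
  rwa [List.map_cons, List.prod_cons, List.length_cons, length_toList_toMultiset] at this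

/-- The linear map sending each monomial to the product of its variables in an arbitrary order. -/
noncomputable def orderedEval (k : Type*) {U : Type*} [Field k] [Ring U] [Algebra k U] {m : ℕ}
    (s : Fin m → U) : MvPolynomial (Fin m) k →ₗ[k] U :=
  (MvPolynomial.basisMonomials (Fin m) k).constr k (monomialWord s)

theorem orderedEval_monomial (s : Fin m → U) (d : Fin m →₀ ℕ) (c : k) :
    orderedEval k s (MvPolynomial.monomial d c) = c • monomialWord s d := by
  have h : orderedEval k s (MvPolynomial.monomial d 1) = monomialWord s d := by
    have := (MvPolynomial.basisMonomials (Fin m) k).constr_basis k (monomialWord s) d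
    simpa [orderedEval] using this
  rw [← h, ← map_smul, MvPolynomial.smul_monomial, smul_eq_mul, mul_one]

theorem orderedEval_X_mul (s : Fin m → U)
    (hc : ∀ i j, s i * s j - s j * s i ∈ Submodule.span k (Set.range s))
    (i : Fin m) {n : ℕ} {f : MvPolynomial (Fin m) k} (hf : f.IsHomogeneous n) :
    s i * orderedEval k s f - orderedEval k s (MvPolynomial.X i * f) ∈ wordSpan k s (n + 1) := by
  have key : ∀ d ∈ f.support,
      s i * orderedEval k s (MvPolynomial.monomial d (f.coeff d)) -
        orderedEval k s (MvPolynomial.X i * MvPolynomial.monomial d (f.coeff d)) ∈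
      wordSpan k s (n + 1) := by
    intro d hd
    have hdn : d.degree = n := by
      have := hf (MvPolynomial.mem_support_iff.1 hd)
      rwa [Finsupp.degree_eq_weight_one]
    rw [MvPolynomial.X, MvPolynomial.monomial_mul, one_mul, orderedEval_monomial,
      orderedEval_monomial, mul_smul_comm, ← smul_sub, ← hdn]
    exact Submodule.smul_mem _ _ (monomialWord_single_add s hc i d)
  have h2 := Submodule.sum_mem _ key
  rw [Finset.sum_sub_distrib, ← Finset.mul_sum, ← map_sum, ← map_sum, ← Finset.mul_sum,
    ← f.as_sum] at h2
  exact h2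

theorem homogeneousComponent_X_mul (i : Fin m) (n : ℕ) (f : MvPolynomial (Fin m) k) :
    MvPolynomial.homogeneousComponent (n + 1) (MvPolynomial.X i * f) =
      MvPolynomial.X i * MvPolynomial.homogeneousComponent n f := by
  ext d
  rw [MvPolynomial.coeff_homogeneousComponent, MvPolynomial.coeff_X_mul', MvPolynomial.coeff_X_mul',
    MvPolynomial.coeff_homogeneousComponent]
  by_cases hi : i ∈ d.support
  · obtain ⟨e, rfl⟩ : ∃ e, d = Finsupp.single i 1 + e := by
      refine ⟨d - Finsupp.single i 1, ?_⟩
      rw [add_tsub_cancel_of_le]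
      rw [Finsupp.single_le_iff]
      exact Nat.one_le_iff_ne_zero.2 (Finsupp.mem_support_iff.1 hi)
    have : (Finsupp.single i 1 + e).degree = n + 1 ↔ e.degree = n := by
      rw [map_add, Finsupp.degree_single]; omega
    simp only [hi, if_true, add_tsub_cancel_left, this]
  · simp [hi]

theorem homogeneousComponent_zero_X_mul (i : Fin m) (f : MvPolynomial (Fin m) k) :
    MvPolynomial.homogeneousComponent 0 (MvPolynomial.X i * f) = 0 := by
  rw [MvPolynomial.homogeneousComponent_zero]
  simp [MvPolynomial.coeff_X_mul']

/-- The ideal of symbols of a left ideal. -/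
noncomputable def symbolIdeal (s : Fin m → U)
    (hc : ∀ i j, s i * s j - s j * s i ∈ Submodule.span k (Set.range s)) (I : Submodule U U) :
    Ideal (MvPolynomial (Fin m) k) where
  carrier := {f | ∀ n, ∃ a ∈ I,
    orderedEval k s (MvPolynomial.homogeneousComponent n f) - a ∈ wordSpan k s n}
  zero_mem' n := ⟨0, I.zero_mem, by simp⟩
  add_mem' {f g} hf hg n := by
    obtain ⟨a, ha, ha'⟩ := hf n
    obtain ⟨b, hb, hb'⟩ := hg n
    exact ⟨a + b, I.add_mem ha hb, by
      rw [map_add, map_add, add_sub_add_comm]; exact add_mem ha' hb'⟩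
  smul_mem' c f hf := by
    rw [smul_eq_mul]
    induction c using MvPolynomial.induction_on generalizing f with
    | C r =>
      intro n
      obtain ⟨a, ha, ha'⟩ := hf n
      refine ⟨algebraMap k U r * a, I.smul_mem _ ha, ?_⟩
      rw [MvPolynomial.homogeneousComponent_C_mul, MvPolynomial.C_mul', map_smul,
        ← Algebra.smul_def, ← smul_sub]
      exact Submodule.smul_mem _ _ ha'
    | add p q hp hq =>
      intro n
      obtain ⟨a, ha, ha'⟩ := hp f hf n
      obtain ⟨b, hb, hb'⟩ := hq f hf n
      exact ⟨a + b, I.add_mem ha hb, by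
        rw [add_mul, map_add, map_add, add_sub_add_comm]; exact add_mem ha' hb'⟩
    | mul_X p i hp =>
      rw [mul_assoc]
      refine hp (MvPolynomial.X i * f) fun n => ?_
      rcases n with _ | n
      · exact ⟨0, I.zero_mem, by rw [homogeneousComponent_zero_X_mul]; simp⟩
      · obtain ⟨a, ha, ha'⟩ := hf n
        refine ⟨s i * a, I.smul_mem _ ha, ?_⟩
        rw [homogeneousComponent_X_mul]
        have h1 := orderedEval_X_mul s hc i
          (MvPolynomial.homogeneousComponent_isHomogeneous n f)
        have h2 := mul_mem_wordSpan s i ha'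
        rw [mul_sub] at h2
        simpa using sub_mem h2 h1

theorem mem_symbolIdeal {s : Fin m → U}
    {hc : ∀ i j, s i * s j - s j * s i ∈ Submodule.span k (Set.range s)} {I : Submodule U U}
    {f : MvPolynomial (Fin m) k} :
    f ∈ symbolIdeal s hc I ↔ ∀ n, ∃ a ∈ I,
      orderedEval k s (MvPolynomial.homogeneousComponent n f) - a ∈ wordSpan k s n :=
  Iff.rfl

theorem exists_homogeneous_sub_mem (s : Fin m → U)
    (hc : ∀ i j, s i * s j - s j * s i ∈ Submodule.span k (Set.range s)) {n : ℕ} {u : U}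
    (hu : u ∈ wordSpan k s (n + 1)) :
    ∃ f : MvPolynomial (Fin m) k, f.IsHomogeneous n ∧ u - orderedEval k s f ∈ wordSpan k s n := by
  induction hu using Submodule.span_induction with
  | mem u hu =>
    obtain ⟨l, hl, rfl⟩ := hu
    rcases Nat.lt_succ_iff_lt_or_eq.1 hl with hl | hl
    · exact ⟨0, MvPolynomial.isHomogeneous_zero _ _ _, by
        simpa using prod_mem_wordSpan s l hl⟩
    · refine ⟨MvPolynomial.monomial (Multiset.toFinsupp (l : Multiset (Fin m))) 1,
        MvPolynomial.isHomogeneous_monomial _ ?_, ?_⟩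
      · rw [← length_toList_toMultiset]; simp [hl]
      · rw [orderedEval_monomial, one_smul, ← hl]
        refine prod_sub_prod_mem_wordSpan s hc ?_
        rw [← Multiset.coe_eq_coe]; simp
  | zero => exact ⟨0, MvPolynomial.isHomogeneous_zero _ _ _, by simp⟩
  | add u v _ _ hu hv =>
    obtain ⟨f, hf, hf'⟩ := hu
    obtain ⟨g, hg, hg'⟩ := hv
    exact ⟨f + g, hf.add hg, by rw [map_add, add_sub_add_comm]; exact add_mem hf' hg'⟩
  | smul c u _ hu =>
    obtain ⟨f, hf, hf'⟩ := hu
    refine ⟨c • f, (MvPolynomial.homogeneousSubmodule (Fin m) k n).smul_mem c hf, ?_⟩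
    rw [map_smul, ← smul_sub]
    exact Submodule.smul_mem _ _ hf'

theorem symbolIdeal_strictMono (s : Fin m → U) (hs : Algebra.adjoin k (Set.range s) = ⊤)
    (hc : ∀ i j, s i * s j - s j * s i ∈ Submodule.span k (Set.range s)) :
    StrictMono (symbolIdeal s hc) := by
  have hmono : Monotone (symbolIdeal s hc) := fun I J hIJ f hf n => by
    obtain ⟨a, ha, ha'⟩ := hf n
    exact ⟨a, hIJ ha, ha'⟩
  intro I J hIJ
  refine lt_of_le_of_ne (hmono hIJ.le) fun heq => hIJ.not_ge ?_
  have key : ∀ n, ∀ u ∈ J, u ∈ wordSpan k s n → u ∈ I := by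
    intro n
    induction n with
    | zero => intro u _ hu; simp [wordSpan] at hu; simp [hu]
    | succ n ih =>
      intro u huJ hu
      obtain ⟨f, hf, hf'⟩ := exists_homogeneous_sub_mem s hc hu
      have hfJ : f ∈ symbolIdeal s hc J := by
        intro n'
        rw [MvPolynomial.homogeneousComponent_of_mem hf]
        split_ifs with h
        · subst h
          exact ⟨u, huJ, by rw [← neg_mem_iff, neg_sub]; exact hf'⟩
        · exact ⟨0, J.zero_mem, by simp⟩
      rw [← heq] at hfJ
      obtain ⟨a, ha, ha'⟩ := mem_symbolIdeal.1 hfJ n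
      rw [MvPolynomial.homogeneousComponent_eq_self hf] at ha'
      have h1 : u - a ∈ wordSpan k s n := by simpa using add_mem hf' ha'
      simpa using I.add_mem (ih (u - a) (J.sub_mem huJ (hIJ.le ha)) h1) ha
  intro u hu
  obtain ⟨n, hn⟩ := exists_mem_wordSpan (k := k) s hs u
  exact key n u hu hn

/-- An algebra generated by a finite-dimensional subspace closed under commutators is
left Noetherian. -/
theorem isNoetherianRing_of_commutator_mem_span (s : Fin m → U)
    (hs : Algebra.adjoin k (Set.range s) = ⊤)
    (hc : ∀ i j, s i * s j - s j * s i ∈ Submodule.span k (Set.range s)) :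
    IsNoetherianRing U := by
  rw [isNoetherianRing_iff, isNoetherian_iff']
  exact (symbolIdeal_strictMono s hs hc).wellFoundedGT

end Noetherian


section Weyl

attribute [local instance] LieRing.ofAssociativeRing

open LieModule

variable {K : Type*} [Field K]

theorem LieAlgebra.hasTrivialRadical_quotient_radical (L : Type*) [LieRing L] [LieAlgebra K L]
    [Module.Finite K L] : LieAlgebra.HasTrivialRadical K (L ⧸ LieAlgebra.radical K L) := by
  set r := LieAlgebra.radical K L
  refine LieAlgebra.hasTrivialRadical_of_no_solvable_ideals fun I hI => ?_
  obtain ⟨n, hn⟩ := (LieAlgebra.isSolvable_iff K _).1 hI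
  rw [LieIdeal.derivedSeries_eq_bot_iff] at hn
  obtain ⟨m, hm⟩ := (LieAlgebra.isSolvable_iff K r).1 inferInstance
  rw [LieIdeal.derivedSeries_eq_bot_iff] at hm
  let π : L →ₗ⁅K⁆ L ⧸ r :=
    { LieSubmodule.Quotient.mk' r with map_lie' := fun {x y} => rfl }
  have hπ (x : L) : π x = 0 ↔ x ∈ r := LieSubmodule.Quotient.mk_eq_zero r
  let J : LieIdeal K L := I.comap π
  have key : ∀ k, ∀ x ∈ LieAlgebra.derivedSeriesOfIdeal K L k J,
      π x ∈ LieAlgebra.derivedSeriesOfIdeal K (L ⧸ r) k I := by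
    intro k
    induction k with
    | zero => intro x hx; exact hx
    | succ k ih =>
      intro x hx
      rw [LieAlgebra.derivedSeriesOfIdeal_succ] at hx ⊢
      rw [← LieSubmodule.mem_toSubmodule, LieSubmodule.lieIdeal_oper_eq_linear_span'] at hx
      induction hx using Submodule.span_induction with
      | mem x hx =>
        obtain ⟨a, ha, b, hb, rfl⟩ := hx
        rw [LieHom.map_lie]
        exact LieSubmodule.lie_mem_lie (ih a ha) (ih b hb)
      | zero => simp
      | add x y _ _ hx hy => rw [map_add]; exact add_mem hx hy
      | smul c x _ hx => rw [map_smul]; exact Submodule.smul_mem _ c hx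
  have h1 : LieAlgebra.derivedSeriesOfIdeal K L n J ≤ r := by
    intro x hx
    have := key n x hx
    rw [hn, LieSubmodule.mem_bot] at this
    exact (hπ x).1 this
  have hJ : J ≤ r := by
    rw [← LieIdeal.solvable_iff_le_radical]
    refine LieAlgebra.IsSolvable.mk (R := K) (k := m + n) ?_
    rw [LieIdeal.derivedSeries_eq_bot_iff, LieAlgebra.derivedSeriesOfIdeal_add, eq_bot_iff, ← hm]
    exact LieAlgebra.derivedSeriesOfIdeal_mono h1 m
  rw [LieSubmodule.eq_bot_iff]
  intro x hx
  obtain ⟨y, rfl⟩ := LieSubmodule.Quotient.surjective_mk' r x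
  exact (hπ y).2 (hJ hx)

theorem LieAlgebra.IsKilling.lie_top_top (g : Type*) [LieRing g] [LieAlgebra K g]
    [Module.Finite K g] [LieAlgebra.IsKilling K g] :
    (⁅(⊤ : LieIdeal K g), (⊤ : LieIdeal K g)⁆ : LieIdeal K g) = ⊤ := by
  set D : LieIdeal K g := ⁅(⊤ : LieIdeal K g), (⊤ : LieIdeal K g)⁆
  have hD := LieIdeal.isCompl_killingCompl (K := K) D
  suffices h : D.killingCompl = ⊥ by simpa [h] using hD.sup_eq_top
  rw [LieSubmodule.eq_bot_iff]
  intro x hx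
  rw [LieIdeal.mem_killingCompl] at hx
  have hc : ∀ y : g, ⁅y, x⁆ = 0 := by
    intro y
    have : ⁅y, x⁆ ∈ LinearMap.ker (killingForm K g) := by
      rw [LinearMap.mem_ker]
      ext z
      rw [LieModule.traceForm_apply_lie_apply', LieModule.traceForm_comm,
        hx _ (LieSubmodule.lie_mem_lie (LieSubmodule.mem_top y) (LieSubmodule.mem_top z))]
      simp
    simpa using this
  have : x ∈ LieAlgebra.center K g := hc
  simpa using this

/-- The Casimir-type endomorphism attached to two finite families. -/
noncomputable def casimir {g ι : Type*} [Fintype ι] [LieRing g] [LieAlgebra K g] (b b' : ι → g)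
    (M : Type*) [AddCommGroup M] [Module K M] [LieRingModule g M] [LieModule K g M] :
    Module.End K M :=
  ∑ i, toEnd K g M (b i) ∘ₗ toEnd K g M (b' i)

theorem casimir_apply {g ι : Type*} [Fintype ι] [LieRing g] [LieAlgebra K g] (b b' : ι → g)
    {M : Type*} [AddCommGroup M] [Module K M] [LieRingModule g M] [LieModule K g M] (v : M) :
    casimir (K := K) b b' M v = ∑ i, ⁅b i, ⁅b' i, v⁆⁆ := by
  simp [casimir]

theorem casimir_lie {g ι : Type*} [Fintype ι] [LieRing g] [LieAlgebra K g] (b b' : ι → g)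
    (B : LinearMap.BilinForm K g) (hinv : ∀ x y z : g, B ⁅x, y⁆ z = - B y ⁅x, z⁆)
    (hb : ∀ (x : g) i, ⁅x, b i⁆ = ∑ k, B ⁅x, b i⁆ (b' k) • b k)
    (hb' : ∀ (x : g) i, ⁅x, b' i⁆ = ∑ k, B (b k) ⁅x, b' i⁆ • b' k)
    {M : Type*} [AddCommGroup M] [Module K M] [LieRingModule g M] [LieModule K g M] (x : g)
    (v : M) : casimir (K := K) b b' M ⁅x, v⁆ = ⁅x, casimir (K := K) b b' M v⁆ := by
  have h1 : ∀ i, ⁅x, ⁅b i, ⁅b' i, v⁆⁆⁆ =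
      ⁅⁅x, b i⁆, ⁅b' i, v⁆⁆ + ⁅b i, ⁅⁅x, b' i⁆, v⁆⁆ + ⁅b i, ⁅b' i, ⁅x, v⁆⁆⁆ := by
    intro i
    rw [leibniz_lie x (b i), leibniz_lie x (b' i), lie_add, add_assoc]
  rw [casimir_apply, casimir_apply, lie_sum]
  simp only [h1, Finset.sum_add_distrib]
  rw [right_eq_add]
  have h2 : ∑ i, ⁅⁅x, b i⁆, ⁅b' i, v⁆⁆ =
      ∑ i, ∑ k, B ⁅x, b i⁆ (b' k) • ⁅b k, ⁅b' i, v⁆⁆ := by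
    refine Finset.sum_congr rfl fun i _ => ?_
    conv_lhs => rw [hb x i, sum_lie]
    simp only [smul_lie]
  have h3 : ∑ i, ⁅b i, ⁅⁅x, b' i⁆, v⁆⁆ =
      ∑ i, ∑ k, B (b k) ⁅x, b' i⁆ • ⁅b i, ⁅b' k, v⁆⁆ := by
    refine Finset.sum_congr rfl fun i _ => ?_
    conv_lhs => rw [hb' x i, sum_lie, lie_sum]
    simp only [smul_lie, lie_smul]
  rw [h2, h3, Finset.sum_comm (f := fun i k => B (b k) ⁅x, b' i⁆ • ⁅b i, ⁅b' k, v⁆⁆),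
    ← Finset.sum_add_distrib]
  refine Finset.sum_eq_zero fun i _ => ?_
  rw [← Finset.sum_add_distrib]
  refine Finset.sum_eq_zero fun k _ => ?_
  rw [← add_smul, hinv]
  simp

theorem exists_dual_families (g : Type*) [LieRing g] [LieAlgebra K g]
    [Module.Finite K g] [LieAlgebra.IsKilling K g] (N : Type*) [AddCommGroup N] [Module K N]
    [LieRingModule g N] [LieModule K g N] (hB : traceForm K g N ≠ 0) :
    ∃ (d : ℕ) (b b' : Fin d → g), d ≠ 0 ∧ (∀ i, traceForm K g N (b i) (b' i) = 1) ∧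
      (∀ (x : g) i, ⁅x, b i⁆ = ∑ k, traceForm K g N ⁅x, b i⁆ (b' k) • b k) ∧
      (∀ (x : g) i, ⁅x, b' i⁆ = ∑ k, traceForm K g N (b k) ⁅x, b' i⁆ • b' k) := by
  set B := traceForm K g N
  have hinv : ∀ x y z : g, B ⁅x, y⁆ z = - B y ⁅x, z⁆ := traceForm_apply_lie_apply' K g N
  let I : LieIdeal K g :=
    { LinearMap.ker B with
      lie_mem := fun {x y} hy => by
        replace hy : B y = 0 := hy
        change B ⁅x, y⁆ = 0
        ext z
        rw [hinv, hy]
        simp }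
  have hI (x : g) : x ∈ I ↔ B x = 0 := Iff.rfl
  set J := I.killingCompl
  have hIJ : IsCompl I J := LieIdeal.isCompl_killingCompl I
  have hsup (x : g) : ∃ y ∈ I, ∃ z ∈ J, y + z = x := by
    rw [← LieSubmodule.mem_sup, hIJ.sup_eq_top]
    trivial
  have hBI (x y : g) (hy : y ∈ I) : B x y = 0 := by
    rw [traceForm_comm]
    change B y x = 0
    rw [(hI y).1 hy]
    rfl
  let BJ : LinearMap.BilinForm K J := B.restrict J.toSubmodule
  have hBJ (x y : J) : BJ x y = B x y := rfl
  have hsymm : BJ.IsSymm := ⟨fun x y => traceForm_comm K g N x y⟩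
  have hnd : BJ.Nondegenerate := by
    refine LinearMap.BilinForm.Nondegenerate.ofSeparatingLeft ?_
    intro x hx
    have : (x : g) ∈ I := by
      rw [hI]
      ext z
      obtain ⟨y, hy, z, hz, rfl⟩ := hsup z
      rw [map_add, hBI _ _ hy, zero_add]
      exact hx ⟨z, hz⟩
    have h0 : (x : g) ∈ I ⊓ J := ⟨this, x.2⟩
    rw [hIJ.inf_eq_bot] at h0
    exact Subtype.ext h0
  have hJ : Nontrivial J := by
    rw [LieSubmodule.nontrivial_iff_ne_bot]
    intro hJ
    apply hB
    ext x y
    obtain ⟨y, hy, z, hz, rfl⟩ := hsup y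
    rw [hJ, LieSubmodule.mem_bot] at hz
    rw [hz, add_zero, hBI _ _ hy]
    rfl
  let b := Module.finBasis K J
  let b' := BJ.dualBasis hnd b
  have e1 (u : g) (hu : u ∈ J) : u = ∑ k, B u (b' k) • (b k : g) := by
    have := b.sum_repr ⟨u, hu⟩
    have h2 (k) : b.repr ⟨u, hu⟩ k = B u (b' k) := by
      have h3 : BJ ⟨u, hu⟩ (b' k) = B u (b' k) := rfl
      rw [← h3]
      conv_rhs => rw [← b.sum_repr ⟨u, hu⟩]
      simp only [map_sum, map_smul, LinearMap.sum_apply, LinearMap.smul_apply, smul_eq_mul, b',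
        LinearMap.BilinForm.apply_dualBasis_right hnd hsymm]
      simp
    have h4 := congrArg (Subtype.val) this
    simp only [h2] at h4
    refine h4.symm.trans ?_
    simp
  have e2 (u : g) (hu : u ∈ J) : u = ∑ k, B (b k) u • (b' k : g) := by
    have := b'.sum_repr ⟨u, hu⟩
    have h2 (k) : b'.repr ⟨u, hu⟩ k = B (b k) u := by
      rw [LinearMap.BilinForm.dualBasis_repr_apply, traceForm_comm]
      rfl
    have h4 := congrArg (Subtype.val) this
    simp only [h2] at h4
    refine h4.symm.trans ?_
    simp
  refine ⟨Module.finrank K J, fun i => b i, fun i => b' i, ?_, ?_, ?_, ?_⟩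
  · exact (Module.finrank_pos (R := K) (M := J)).ne'
  · intro i
    have := LinearMap.BilinForm.apply_dualBasis_right hnd hsymm b i i
    rw [if_pos rfl] at this
    exact this
  · exact fun x i => e1 _ (lie_mem_right K g J x _ (b i).2)
  · exact fun x i => e2 _ (lie_mem_right K g J x _ (b' i).2)



theorem exists_lie_sub_eq_zero_of_irreducible [CharZero K] {g : Type*} [LieRing g]
    [LieAlgebra K g] [Module.Finite K g] [LieAlgebra.IsKilling K g] {M : Type*}
    [AddCommGroup M] [Module K M] [LieRingModule g M] [LieModule K g M] (N : LieSubmodule K g M)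
    [Module.Finite K N] (hirr : ∀ N₁ : LieSubmodule K g M, N₁ ≤ N → N₁ = ⊥ ∨ N₁ = N)
    (m : M) (hm : ∀ x : g, ⁅x, m⁆ ∈ N) : ∃ n ∈ N, ∀ x : g, ⁅x, m - n⁆ = 0 := by
  by_cases hN : N = ⊥
  · exact ⟨0, N.zero_mem, fun x => by simpa [hN] using hm x⟩
  have hnt : Nontrivial N := (LieSubmodule.nontrivial_iff_ne_bot K g M).2 hN
  by_cases hB : traceForm K g N = 0
  · refine ⟨0, N.zero_mem, ?_⟩
    have h1 := isNilpotent_derivedSeries_of_traceForm_eq_zero hB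
    have h2 := nontrivial_max_triv_of_isNilpotent K (LieAlgebra.derivedSeries K g 1) N
    obtain ⟨⟨n, hn⟩, hn0⟩ := exists_ne (0 : maxTrivSubmodule K (LieAlgebra.derivedSeries K g 1) N)
    have hD : LieAlgebra.derivedSeries K g 1 = ⊤ := LieAlgebra.IsKilling.lie_top_top g
    have htriv : ∀ x : g, ∀ n ∈ N, ⁅x, n⁆ = 0 := by
      rcases hirr (N ⊓ maxTrivSubmodule K g M) inf_le_left with h | h
      · exfalso
        apply hn0
        have : (n : M) ∈ N ⊓ maxTrivSubmodule K g M := by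
          refine ⟨n.2, fun x => ?_⟩
          exact congrArg Subtype.val (hn ⟨x, by rw [hD]; trivial⟩)
        rw [h] at this
        exact Subtype.ext (Subtype.ext this)
      · intro x n hn
        rw [← h] at hn
        exact hn.2 x
    intro x
    rw [sub_zero]
    have hx : x ∈ (⁅(⊤ : LieIdeal K g), (⊤ : LieIdeal K g)⁆ : LieIdeal K g) := by
      rw [LieAlgebra.IsKilling.lie_top_top g]
      trivial
    rw [← LieSubmodule.mem_toSubmodule, LieSubmodule.lieIdeal_oper_eq_linear_span'] at hx
    induction hx using Submodule.span_induction with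
    | mem x hx =>
      obtain ⟨a, ha, b, hb, rfl⟩ := hx
      rw [lie_lie, htriv _ _ (hm b), htriv _ _ (hm a), sub_zero]
    | zero => simp
    | add x y _ _ hx hy => rw [add_lie, hx, hy, add_zero]
    | smul c x _ hx => rw [smul_lie, hx, smul_zero]
  · obtain ⟨d, b, b', hd, htr, hb, hb'⟩ := exists_dual_families g N hB
    have hinv : ∀ x y z : g, traceForm K g N ⁅x, y⁆ z = - traceForm K g N y ⁅x, z⁆ :=
      traceForm_apply_lie_apply' K g N
    have hc := fun x (v : M) => casimir_lie b b' _ hinv hb hb' x v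
    set c := casimir (K := K) b b' M
    have hcN : ∀ n ∈ N, c n ∈ N := by
      intro n hn
      rw [casimir_apply]
      exact sum_mem fun i _ => N.lie_mem (N.lie_mem hn)
    have hcm : c m ∈ N := by
      rw [casimir_apply]
      exact sum_mem fun i _ => N.lie_mem (hm _)
    have hcr : ∀ n : N, c n = (casimir (K := K) b b' N n : N) := by
      intro n
      rw [casimir_apply, casimir_apply]
      simp
    have htrc : LinearMap.trace K N (casimir (K := K) b b' N) = d := by
      simp only [casimir, map_sum]
      simp only [traceForm_apply_apply] at htr
      simp [htr]
    have hinj : ∀ n ∈ N, c n = 0 → n = 0 := by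
      let N₁ : LieSubmodule K g M :=
        { N.toSubmodule ⊓ LinearMap.ker c with
          lie_mem := fun {x n} hn => ⟨N.lie_mem hn.1, by
            have h2 : c n = 0 := hn.2
            change c ⁅x, n⁆ = 0
            rw [hc, h2, lie_zero]⟩ }
      have hN₁ (n) : n ∈ N₁ ↔ n ∈ N ∧ c n = 0 := Iff.rfl
      rcases hirr N₁ (fun n hn => hn.1) with h | h
      · intro n hn hn0
        have := (hN₁ n).2 ⟨hn, hn0⟩
        rwa [h] at this
      · exfalso
        have : casimir (K := K) b b' N = 0 := by
          ext n
          have hn : (n : M) ∈ N₁ := h.symm ▸ n.2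
          rw [← hcr]
          exact hn.2
        rw [this, map_zero] at htrc
        exact hd (by exact_mod_cast htrc.symm)
    have hinj' : Function.Injective (casimir (K := K) b b' N) := by
      rw [← LinearMap.ker_eq_bot, LinearMap.ker_eq_bot']
      intro n hn
      apply Subtype.ext
      exact hinj n n.2 (by rw [hcr, hn]; rfl)
    obtain ⟨n, hn⟩ := LinearMap.injective_iff_surjective.1 hinj' ⟨c m, hcm⟩
    refine ⟨n, n.2, fun x => ?_⟩
    apply hinj
    · rw [lie_sub]
      exact sub_mem (hm x) (N.lie_mem n.2)
    · rw [hc, map_sub, hcr, hn, sub_self, lie_zero]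

theorem exists_lie_sub_eq_zero_of_isKilling [CharZero K] {g : Type*} [LieRing g]
    [LieAlgebra K g] [Module.Finite K g] [LieAlgebra.IsKilling K g] (k : ℕ) :
    ∀ {M : Type*} [AddCommGroup M] [Module K M] [LieRingModule g M] [LieModule K g M]
    (N : LieSubmodule K g M) [Module.Finite K N], Module.finrank K N ≤ k →
    ∀ (m : M), (∀ x : g, ⁅x, m⁆ ∈ N) → ∃ n ∈ N, ∀ x : g, ⁅x, m - n⁆ = 0 := by
  induction k with
  | zero =>
    intro M _ _ _ _ N _ hN m hm
    have : N = ⊥ := by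
      rw [← LieSubmodule.toSubmodule_eq_bot]
      exact Submodule.finrank_eq_zero.1 (Nat.le_zero.1 hN)
    exact ⟨0, N.zero_mem, fun x => by simpa [this] using hm x⟩
  | succ k ih =>
    intro M _ _ _ _ N _ hN m hm
    by_cases hirr : ∀ N₁ : LieSubmodule K g M, N₁ ≤ N → N₁ = ⊥ ∨ N₁ = N
    · exact exists_lie_sub_eq_zero_of_irreducible N hirr m hm
    push Not at hirr
    obtain ⟨N₁, hle, hbot, hne⟩ := hirr
    have hlt : N₁.toSubmodule < N.toSubmodule :=
      lt_of_le_of_ne hle fun h => hne (LieSubmodule.toSubmodule_injective h)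
    have : Module.Finite K N.toSubmodule := ‹_›
    have hfin : Module.Finite K N₁ := Submodule.finiteDimensional_of_le hle
    have hrk : Module.finrank K N₁ < Module.finrank K N := Submodule.finrank_lt_finrank_of_lt hlt
    let π := LieSubmodule.Quotient.mk' N₁
    have hπ (x : M) : π x = 0 ↔ x ∈ N₁ := LieSubmodule.Quotient.mk_eq_zero N₁
    let N' : LieSubmodule K g (M ⧸ N₁) := N.map π
    let f := (π : M →ₗ[K] M ⧸ N₁).domRestrict N.toSubmodule
    have hf : LinearMap.range f = N'.toSubmodule := LinearMap.range_domRestrict _ _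
    have h1 := f.finrank_range_add_finrank_ker
    have hfin' : Module.Finite K N' := by
      change Module.Finite K N'.toSubmodule
      rw [← hf]
      infer_instance
    have hker : LinearMap.ker f ≠ ⊥ := by
      rw [Ne, LieSubmodule.eq_bot_iff] at hbot
      push Not at hbot
      obtain ⟨x, hx, hx0⟩ := hbot
      intro h
      apply hx0
      have : (⟨x, hle hx⟩ : N.toSubmodule) ∈ LinearMap.ker f := (hπ x).2 hx
      rw [h] at this
      exact congrArg Subtype.val this
    have h2 : Module.finrank K (LinearMap.ker f) ≠ 0 := fun h =>
      hker (Submodule.finrank_eq_zero.1 h)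
    have hrk' : Module.finrank K N' ≤ k := by
      change Module.finrank K N'.toSubmodule ≤ k
      rw [← hf]
      change Module.finrank K N.toSubmodule ≤ _ at hN
      omega
    obtain ⟨n', hn', h'⟩ := ih N' hrk' (π m) (fun x => by
      rw [← π.map_lie]
      exact LieSubmodule.mem_map_of_mem (hm x))
    obtain ⟨n, hn, rfl⟩ := (LieSubmodule.mem_map _).1 hn'
    obtain ⟨n₁, hn₁, h₁⟩ := ih N₁ (by omega) (m - n) (fun x => by
      rw [← hπ, π.map_lie, map_sub, h'])
    refine ⟨n + n₁, add_mem hn (hle hn₁), fun x => ?_⟩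
    rw [← sub_sub, h₁]

theorem exists_sub_apply_eq_zero [CharZero K] {L : Type*} [LieRing L] [LieAlgebra K L]
    [Module.Finite K L] {M : Type*} [AddCommGroup M] [Module K M] (θ : L →ₗ⁅K⁆ Module.End K M)
    (hr : ∀ y ∈ LieAlgebra.radical K L, θ y = 0) (N : Submodule K M) [Module.Finite K N]
    (hN : ∀ x, ∀ n ∈ N, θ x n ∈ N) (m : M) (hm : ∀ x, θ x m ∈ N) :
    ∃ n ∈ N, ∀ x, θ x (m - n) = 0 := by
  set r := LieAlgebra.radical K L
  have := LieAlgebra.hasTrivialRadical_quotient_radical (K := K) L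
  let f : (L ⧸ r) →ₗ[K] Module.End K M := r.toSubmodule.liftQ θ.toLinearMap hr
  have hf (x : L) : f (LieSubmodule.Quotient.mk x) = θ x := rfl
  let φ : (L ⧸ r) →ₗ⁅K⁆ Module.End K M :=
    { f with
      map_lie' := fun {x y} => by
        obtain ⟨x, rfl⟩ := LieSubmodule.Quotient.surjective_mk' r x
        obtain ⟨y, rfl⟩ := LieSubmodule.Quotient.surjective_mk' r y
        exact θ.map_lie x y }
  let _ : LieRingModule (L ⧸ r) M := LieRingModule.compLieHom M φ
  have : LieModule K (L ⧸ r) M := LieModule.compLieHom M φ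
  let N' : LieSubmodule K (L ⧸ r) M :=
    { N with
      lie_mem := fun {x n} hn => by
        obtain ⟨x, rfl⟩ := LieSubmodule.Quotient.surjective_mk' r x
        exact hN x n hn }
  have : Module.Finite K N' := ‹Module.Finite K N›
  obtain ⟨n, hn, h⟩ := exists_lie_sub_eq_zero_of_isKilling _ N' le_rfl m (fun x => by
    obtain ⟨x, rfl⟩ := LieSubmodule.Quotient.surjective_mk' r x
    exact hm x)
  exact ⟨n, hn, fun x => h (LieSubmodule.Quotient.mk x)⟩

end Weyl


section AdjointAction

attribute [local instance] LieRing.ofAssociativeRing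

open LieModule

theorem Commute.mul_sub_mul_of_lie {R : Type*} [Ring R] {k x b : R} (h : Commute k b)
    (h' : Commute ⁅x, k⁆ b) : Commute k (x * b - b * x) := by
  have h1 : k * b - b * k = 0 := sub_eq_zero.2 h
  have h2 : (x * k - k * x) * b - b * (x * k - k * x) = 0 := sub_eq_zero.2 h'
  refine sub_eq_zero.1 ?_
  calc k * (x * b - b * x) - (x * b - b * x) * k
      = -((x * k - k * x) * b - b * (x * k - k * x)) - (k * b - b * k) * x
        + x * (k * b - b * k) := by noncomm_ring
    _ = 0 := by rw [h1, h2]; simp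

theorem LieModule.exists_ne_zero_lie_lie_radical_eq_zero {k L M : Type*} [Field k] [CharZero k]
    [IsAlgClosed k] [LieRing L] [LieAlgebra k L] [Module.Finite k L] [AddCommGroup M] [Module k M]
    [LieRingModule L M] [LieModule k L M] [Module.Finite k M] [Nontrivial M] :
    ∃ m : M, m ≠ 0 ∧ ∀ x : L, ∀ y ∈ LieAlgebra.radical k L, ⁅⁅x, y⁆, m⁆ = 0 := by
  obtain ⟨χ, hχ⟩ := exists_nontrivial_weightSpace_of_isSolvable k (LieAlgebra.radical k L) M
  let N : LieSubmodule k L M := weightSpaceOfIsLieTower k M χ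
  have hN (m : M) (hm : m ∈ N) (y : L) (hy : y ∈ LieAlgebra.radical k L) :
      ⁅y, m⁆ = χ ⟨y, hy⟩ • m := by
    have := (mem_weightSpace (χ := χ) (m := m)).1 hm ⟨y, hy⟩
    exact this
  obtain ⟨⟨m, hm⟩, hm0⟩ := exists_ne (0 : weightSpace M χ)
  have hm : m ∈ N := hm
  refine ⟨m, fun h => hm0 (Subtype.ext h), fun x y hy => ?_⟩
  rw [lie_lie, hN m hm y hy, hN _ (N.lie_mem hm) y hy, lie_smul, sub_self]

theorem exists_ne_zero_commute_lie_radical {L A : Type*} [LieRing L] [LieAlgebra ℂ L]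
    [Module.Finite ℂ L] [Ring A] [Algebra ℂ A] (κ : L →ₗ⁅ℂ⁆ A) (P : Submodule ℂ A)
    [Module.Finite ℂ P] (hP : ∀ x, ∀ b ∈ P, κ x * b - b * κ x ∈ P) (hP0 : P ≠ ⊥) :
    ∃ m ∈ P, m ≠ 0 ∧ ∀ x : L, ∀ y ∈ LieAlgebra.radical ℂ L, Commute (κ ⁅x, y⁆) m := by
  let _ : LieRingModule L A := LieRingModule.compLieHom A κ
  have : LieModule ℂ L A := LieModule.compLieHom A κ
  let P' : LieSubmodule ℂ L A := { P with lie_mem := fun {x b} hb => hP x b hb }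
  have : Module.Finite ℂ P' := ‹Module.Finite ℂ P›
  have : Nontrivial P' := (LieSubmodule.nontrivial_iff_ne_bot ℂ L A).2 fun h => hP0 <| by
    simpa [P'] using congrArg LieSubmodule.toSubmodule h
  obtain ⟨m, hm, h⟩ := exists_ne_zero_lie_lie_radical_eq_zero (k := ℂ) (L := L) (M := P')
  refine ⟨m, m.2, fun h => hm (Subtype.ext h), fun x y hy => ?_⟩
  have := congrArg Subtype.val (h x y hy)
  exact sub_eq_zero.1 this

/-- Local finiteness and complete reducibility of the adjoint action of a Lie algebra on an
algebra receiving a Lie homomorphism. -/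
def AdSemisimple {L A : Type*} [LieRing L] [LieAlgebra ℂ L] [Ring A] [Algebra ℂ A]
    (κ : L → A) : Prop :=
  ∀ a : A, ∃ F : Submodule ℂ A, FiniteDimensional ℂ F ∧ a ∈ F ∧
    (∀ x, ∀ b ∈ F, κ x * b - b * κ x ∈ F) ∧
    (∀ S : Submodule ℂ A, S ≤ F → (∀ x, ∀ b ∈ S, κ x * b - b * κ x ∈ S) →
      ∃ S' : Submodule ℂ A, S' ≤ F ∧ (∀ x, ∀ b ∈ S', κ x * b - b * κ x ∈ S') ∧
        S ⊓ S' = ⊥ ∧ S ⊔ S' = F)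

theorem AdSemisimple.commute_lie_radical {L A : Type*} [LieRing L] [LieAlgebra ℂ L]
    [Module.Finite ℂ L] [Ring A] [Algebra ℂ A] (κ : L →ₗ⁅ℂ⁆ A) (h : AdSemisimple κ)
    (x : L) {y : L} (hy : y ∈ LieAlgebra.radical ℂ L) (a : A) : Commute (κ ⁅x, y⁆) a := by
  obtain ⟨F, hF, ha, hst, hc⟩ := h a
  let C : Submodule ℂ A := ⨅ x : L, ⨅ y : LieAlgebra.radical ℂ L,
    LinearMap.ker (LinearMap.mulLeft ℂ (κ ⁅x, (y : L)⁆) - LinearMap.mulRight ℂ (κ ⁅x, (y : L)⁆))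
  have hC (b : A) : b ∈ C ↔ ∀ x : L, ∀ y ∈ LieAlgebra.radical ℂ L, Commute (κ ⁅x, y⁆) b := by
    simp [C, Submodule.mem_iInf, sub_eq_zero, Commute, SemiconjBy]
  have hstC : ∀ x, ∀ b ∈ F ⊓ C, κ x * b - b * κ x ∈ F ⊓ C := by
    rintro x b ⟨hbF, hbC⟩
    refine ⟨hst x b hbF, (hC _).2 ?_⟩
    replace hbC := (hC b).1 hbC
    intro z y hy
    have h1 := hbC z y hy
    have h2 := hbC x ⁅z, y⁆ (lie_mem_right ℂ L _ z y hy)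
    rw [LieHom.map_lie] at h2
    exact h1.mul_sub_mul_of_lie h2
  obtain ⟨P', hle, hst', hinf, hsup⟩ := hc (F ⊓ C) inf_le_left hstC
  have hfin : Module.Finite ℂ P' := Submodule.finiteDimensional_of_le hle
  have hbot : P' = ⊥ := by
    by_contra h0
    obtain ⟨m, hm, hm0, hmc⟩ := exists_ne_zero_commute_lie_radical κ P' hst' h0
    apply hm0
    have : m ∈ F ⊓ C ⊓ P' := ⟨⟨hle hm, (hC m).2 hmc⟩, hm⟩
    rwa [hinf] at this
  rw [hbot, sup_bot_eq] at hsup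
  rw [← hsup] at ha
  exact (hC a).1 ha.2 x y hy

theorem AdSemisimple.map_lie_radical {L A : Type*} [LieRing L] [LieAlgebra ℂ L]
    [Module.Finite ℂ L] [Ring A] [Algebra ℂ A] (κ : L →ₗ⁅ℂ⁆ A) (h : AdSemisimple κ)
    (x : L) {y : L} (hy : y ∈ LieAlgebra.radical ℂ L) : κ ⁅x, y⁆ = 0 := by
  obtain ⟨F, hF, ha, hst, hc⟩ := h (κ x)
  let C : Submodule ℂ A := ⨅ y : LieAlgebra.radical ℂ L,
    LinearMap.ker (LinearMap.mulLeft ℂ (κ (y : L)) - LinearMap.mulRight ℂ (κ (y : L)))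
  have hC (b : A) : b ∈ C ↔ ∀ y ∈ LieAlgebra.radical ℂ L, Commute (κ y) b := by
    simp [C, Submodule.mem_iInf, sub_eq_zero, Commute, SemiconjBy]
  have hcomm := fun x y hy a => AdSemisimple.commute_lie_radical κ h x (y := y) hy a
  have hstC : ∀ x, ∀ b ∈ F ⊓ C, κ x * b - b * κ x ∈ F ⊓ C := by
    rintro x b ⟨hbF, hbC⟩
    refine ⟨hst x b hbF, (hC _).2 ?_⟩
    replace hbC := (hC b).1 hbC
    intro y hy
    have h1 := hbC y hy
    have h2 := hcomm x y hy b
    rw [LieHom.map_lie] at h2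
    exact h1.mul_sub_mul_of_lie h2
  obtain ⟨P', hle, hst', hinf, hsup⟩ := hc (F ⊓ C) inf_le_left hstC
  rw [← hsup, Submodule.mem_sup] at ha
  obtain ⟨c, hcC, p, hp, hx⟩ := ha
  have hcC' := (hC c).1 hcC.2
  have h1 : ∀ y ∈ LieAlgebra.radical ℂ L, κ y * p - p * κ y = 0 := by
    intro y hy
    have h2 : κ y * p - p * κ y = κ ⁅y, x⁆ := by
      rw [LieHom.map_lie, ← hx]
      change _ = κ y * (c + p) - (c + p) * κ y
      rw [mul_add, add_mul, (hcC' y hy).eq]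
      abel
    have : κ y * p - p * κ y ∈ F ⊓ C ⊓ P' := by
      refine ⟨⟨hle (hst' y p hp), (hC _).2 fun y' hy' => ?_⟩, hst' y p hp⟩
      rw [h2, ← lie_skew, map_neg]
      exact ((hcomm x y hy _).symm).neg_right
    rwa [hinf] at this
  have h2 : p ∈ F ⊓ C ⊓ P' :=
    ⟨⟨hle hp, (hC _).2 fun y hy => sub_eq_zero.1 (h1 y hy)⟩, hp⟩
  rw [hinf] at h2
  rw [(Submodule.mem_bot ℂ).1 h2, add_zero] at hx
  rw [LieHom.map_lie, ← hx]
  exact sub_eq_zero.2 (hcC' y hy).symm.eq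

end AdjointAction


section Polarization

open Polynomial in
theorem Submodule.coeff_mem_of_forall_sum_mem {M : Type*} [AddCommGroup M] [Module ℂ M]
    (W : Submodule ℂ M) (N : ℕ) (c : ℕ → M)
    (h : ∀ t : ℂ, ∑ i ∈ Finset.range N, t ^ i • c i ∈ W) (i : ℕ) (hi : i < N) : c i ∈ W := by
  rw [← Submodule.Quotient.mk_eq_zero, ← Module.forall_dual_apply_eq_zero_iff ℂ]
  intro f
  let p : ℂ[X] := ∑ i ∈ Finset.range N, C (f (W.mkQ (c i))) * X ^ i
  have hp : p = 0 := by
    refine Polynomial.funext fun t => ?_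
    have := (Submodule.Quotient.mk_eq_zero W).2 (h t)
    rw [← Submodule.mkQ_apply] at this
    have := congrArg f this
    rw [map_sum, map_sum, map_zero] at this
    simp only [map_smul, smul_eq_mul] at this
    simp only [p, eval_finsetSum, eval_mul, eval_C, eval_pow, eval_X, eval_zero]
    rw [← this]
    exact Finset.sum_congr rfl fun i _ => mul_comm _ _
  have := congrArg (fun q => coeff q i) hp
  simpa [p, finsetSum_coeff, coeff_C_mul, coeff_X_pow, hi] using this

/-- The derivative of `x ^ n` in the direction `y`. -/
def polarPow {R : Type*} [Ring R] (x y : R) (n : ℕ) : R := ∑ i ∈ Finset.range n, x ^ i * y * x ^ (n - 1 - i)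

theorem polarPow_succ {R : Type*} [Ring R] (x y : R) (n : ℕ) :
    polarPow x y (n + 1) = x * polarPow x y n + y * x ^ n := by
  rw [polarPow, Finset.sum_range_succ', polarPow, Finset.mul_sum]
  simp only [pow_zero, one_mul, Nat.sub_zero, Nat.add_sub_cancel]
  congr 1
  refine Finset.sum_congr rfl fun i hi => ?_
  rw [pow_succ', mul_assoc, mul_assoc, mul_assoc]
  congr 4
  omega

theorem mul_pow_sub_pow_mul {R : Type*} [Ring R] (x y : R) (n : ℕ) :
    y * x ^ n - x ^ n * y = polarPow x (y * x - x * y) n := by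
  induction n with
  | zero => simp [polarPow]
  | succ n ih =>
    rw [polarPow_succ, ← ih]
    rw [pow_succ']
    generalize x ^ n = w
    noncomm_ring

variable {R : Type*} [Ring R] [Algebra ℂ R]

theorem exists_add_smul_pow_eq_sum (x y : R) (n : ℕ) : ∃ c : ℕ → R,
    c 1 = polarPow x y n ∧ ∀ t : ℂ, (x + t • y) ^ n = ∑ i ∈ Finset.range (n + 2), t ^ i • c i := by
  suffices h : ∃ c : ℕ → R, c 0 = x ^ n ∧ c 1 = polarPow x y n ∧ (∀ i, n + 1 ≤ i → c i = 0) ∧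
      ∀ t : ℂ, (x + t • y) ^ n = ∑ i ∈ Finset.range (n + 2), t ^ i • c i by
    obtain ⟨c, -, h1, -, h2⟩ := h
    exact ⟨c, h1, h2⟩
  induction n with
  | zero =>
    refine ⟨fun i => if i = 0 then 1 else 0, by simp, by simp [polarPow], fun i hi => ?_, ?_⟩
    · exact if_neg (by omega)
    · intro t
      simp
  | succ n ih =>
    obtain ⟨c, h0, h1, hc, h⟩ := ih
    refine ⟨fun i => x * c i + if i = 0 then 0 else y * c (i - 1), ?_, ?_, ?_, ?_⟩
    · simp [h0, pow_succ']
    · simp [h0, h1, polarPow_succ]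
    · intro i hi
      dsimp only
      rw [if_neg (by omega), hc i (by omega), hc (i - 1) (by omega)]
      simp
    · intro t
      rw [pow_succ', h, add_mul, Finset.mul_sum, Finset.mul_sum]
      simp only [smul_add, Finset.sum_add_distrib]
      congr 1
      · rw [Finset.sum_range_succ _ (n + 2), hc (n + 2) (by omega)]
        simp
      · rw [Finset.sum_range_succ' _ (n + 2)]
        rw [if_pos rfl, smul_zero, add_zero]
        refine Finset.sum_congr rfl fun i _ => ?_
        simp [pow_succ, smul_smul, mul_comm]

theorem polarPow_mem (W : Submodule ℂ R) (x y : R) (n : ℕ) (h : ∀ t : ℂ, (x + t • y) ^ n ∈ W) :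
    polarPow x y n ∈ W := by
  obtain ⟨c, h1, h2⟩ := exists_add_smul_pow_eq_sum x y n
  rw [← h1]
  refine Submodule.coeff_mem_of_forall_sum_mem W (n + 2) c (fun t => ?_) 1 (by omega)
  rw [← h2]
  exact h t

theorem pow_mul_mul_pow_mem (q : Submodule ℂ R) (hq : ∀ x ∈ q, ∀ y ∈ q, x * y - y * x ∈ q)
    (W : Submodule ℂ R) (hW : ∀ x ∈ q, ∀ n : ℕ, x ^ n ∈ W) (n : ℕ) :
    ∀ x ∈ q, ∀ y ∈ q, ∀ a b : ℕ, a + b = n → x ^ a * y * x ^ b ∈ W := by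
  induction n with
  | zero =>
    intro x hx y hy a b hab
    obtain ⟨rfl, rfl⟩ : a = 0 ∧ b = 0 := by omega
    simpa using hW y hy 1
  | succ n ih =>
    intro x hx y hy a b hab
    have hstep : ∀ i, i ≤ n →
        x ^ (i + 1) * y * x ^ (n - i) - x ^ i * y * x ^ (n - i + 1) ∈ W := by
      intro i hi
      have : x ^ (i + 1) * y * x ^ (n - i) - x ^ i * y * x ^ (n - i + 1) =
          x ^ i * (x * y - y * x) * x ^ (n - i) := by
        rw [pow_succ x i, pow_succ' x (n - i)]
        noncomm_ring
      rw [this]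
      exact ih x hx _ (hq x hx y hy) _ _ (by omega)
    have h0 : ∀ i, i ≤ n + 1 → x ^ i * y * x ^ (n + 1 - i) - y * x ^ (n + 1) ∈ W := by
      intro i
      induction i with
      | zero => intro _; simp
      | succ i ihi =>
        intro hi
        have h1 := ihi (by omega)
        have h2 := hstep i (by omega)
        have e1 : n + 1 - (i + 1) = n - i := by omega
        have e2 : n + 1 - i = n - i + 1 := by omega
        rw [e2] at h1
        rw [e1]
        simpa using add_mem h2 h1
    have hsum : polarPow x y (n + 2) ∈ W :=
      polarPow_mem W x y _ fun t => hW _ (add_mem hx (q.smul_mem t hy)) _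
    have h1 : ((n + 2 : ℕ) : ℂ) • (y * x ^ (n + 1)) ∈ W := by
      have h2 : ∑ i ∈ Finset.range (n + 2), (x ^ i * y * x ^ (n + 1 - i) - y * x ^ (n + 1)) ∈ W :=
        sum_mem fun i hi => h0 i (by have := Finset.mem_range.1 hi; omega)
      rw [Finset.sum_sub_distrib, Finset.sum_const, Finset.card_range] at h2
      have h3 := sub_mem hsum h2
      rw [polarPow] at h3
      simp only [show n + 2 - 1 = n + 1 by omega, sub_sub_cancel] at h3
      rwa [Nat.cast_smul_eq_nsmul]
    have h2 : y * x ^ (n + 1) ∈ W :=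
      (W.smul_mem_iff (by exact_mod_cast (by omega : n + 2 ≠ 0))).1 h1
    have h3 := add_mem (h0 a (by omega)) h2
    rw [sub_add_cancel] at h3
    convert h3 using 3
    omega

theorem iSup_span_pow_eq_top (q : Submodule ℂ R) (hq : ∀ x ∈ q, ∀ y ∈ q, x * y - y * x ∈ q)
    (hgen : Algebra.adjoin ℂ (q : Set R) = ⊤) :
    (⨆ n : ℕ, Submodule.span ℂ {u : R | ∃ x ∈ q, x ^ n = u}) = ⊤ := by
  set W := ⨆ n : ℕ, Submodule.span ℂ {u : R | ∃ x ∈ q, x ^ n = u}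
  have hW : ∀ x ∈ q, ∀ n : ℕ, x ^ n ∈ W := fun x hx n =>
    Submodule.mem_iSup_of_mem n (Submodule.subset_span ⟨x, hx, rfl⟩)
  have hmul : ∀ y ∈ q, ∀ w ∈ W, y * w ∈ W := by
    intro y hy
    change W ≤ W.comap (LinearMap.mulLeft ℂ y)
    refine iSup_le fun n => Submodule.span_le.2 ?_
    rintro _ ⟨x, hx, rfl⟩
    have := pow_mul_mul_pow_mem q hq W hW n x hx y hy 0 n (by omega)
    simpa using this
  have hmul' : ∀ u : R, ∀ w ∈ W, u * w ∈ W := by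
    intro u
    have hu : u ∈ Algebra.adjoin ℂ (q : Set R) := by rw [hgen]; trivial
    induction hu using Algebra.adjoin_induction with
    | mem x hx => exact hmul x hx
    | algebraMap r =>
      intro w hw
      rw [← Algebra.smul_def]
      exact W.smul_mem r hw
    | add x y _ _ hx hy => intro w hw; rw [add_mul]; exact add_mem (hx w hw) (hy w hw)
    | mul x y _ _ hx hy => intro w hw; rw [mul_assoc]; exact hx _ (hy w hw)
  rw [eq_top_iff]
  intro u _
  have := hmul' u 1 (by simpa using hW 0 q.zero_mem 0)
  rwa [mul_one] at this

end Polarization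


namespace UniversalEnvelopingAlgebra

open TensorProduct

attribute [local instance] LieRing.ofAssociativeRing

variable {L : Type*} [LieRing L] [LieAlgebra ℂ L]

theorem ι_lie (x y : L) : ι ℂ ⁅x, y⁆ = ι ℂ x * ι ℂ y - ι ℂ y * ι ℂ x :=
  LieHom.map_lie _ _ _

variable (L) in
/-- The subspace of generators of the universal enveloping algebra. -/
noncomputable def genSpace : Submodule ℂ (UniversalEnvelopingAlgebra ℂ L) :=
  LinearMap.range (ι ℂ : L →ₗ⁅ℂ⁆ UniversalEnvelopingAlgebra ℂ L).toLinearMap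

theorem ι_mem_genSpace (x : L) : ι ℂ x ∈ genSpace L := ⟨x, rfl⟩

theorem mem_genSpace {u : UniversalEnvelopingAlgebra ℂ L} :
    u ∈ genSpace L ↔ ∃ x, ι ℂ x = u := Iff.rfl

theorem commutator_mem_genSpace {u v : UniversalEnvelopingAlgebra ℂ L} (hu : u ∈ genSpace L)
    (hv : v ∈ genSpace L) : u * v - v * u ∈ genSpace L := by
  obtain ⟨x, rfl⟩ := mem_genSpace.1 hu
  obtain ⟨y, rfl⟩ := mem_genSpace.1 hv
  rw [← ι_lie]
  exact ι_mem_genSpace _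

theorem adjoin_genSpace :
    Algebra.adjoin ℂ (genSpace L : Set (UniversalEnvelopingAlgebra ℂ L)) = ⊤ := by
  set S := Algebra.adjoin ℂ (genSpace L : Set (UniversalEnvelopingAlgebra ℂ L))
  have hS : ∀ x : L, ι ℂ x ∈ S := fun x => Algebra.subset_adjoin (ι_mem_genSpace x)
  let f : L →ₗ⁅ℂ⁆ S :=
    { toFun := fun x => ⟨ι ℂ x, hS x⟩
      map_add' := fun x y => Subtype.ext (map_add _ _ _)
      map_smul' := fun c x => Subtype.ext (map_smul _ _ _)
      map_lie' := fun {x y} => Subtype.ext (ι_lie x y) }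
  have h : S.val.comp (lift ℂ f) = AlgHom.id ℂ _ := by
    apply hom_ext
    ext x
    change ((lift ℂ f (ι ℂ x) : S) : UniversalEnvelopingAlgebra ℂ L) = ι ℂ x
    rw [lift_ι_apply]
    rfl
  rw [eq_top_iff]
  intro u _
  have := congrArg (fun g => g u) h
  change ((lift ℂ f u : S) : UniversalEnvelopingAlgebra ℂ L) = u at this
  rw [← this]
  exact (lift ℂ f u).2

@[elab_as_elim]
theorem induction_on {p : UniversalEnvelopingAlgebra ℂ L → Prop} (u : UniversalEnvelopingAlgebra ℂ L)
    (algebraMap : ∀ c : ℂ, p (algebraMap ℂ _ c)) (gen : ∀ x : L, p (ι ℂ x))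
    (add : ∀ u v, p u → p v → p (u + v)) (mul : ∀ u v, p u → p v → p (u * v)) : p u := by
  have hu : u ∈ Algebra.adjoin ℂ (genSpace L : Set (UniversalEnvelopingAlgebra ℂ L)) := by
    rw [adjoin_genSpace]
    trivial
  induction hu using Algebra.adjoin_induction with
  | mem x hx =>
    obtain ⟨x, rfl⟩ := mem_genSpace.1 hx
    exact gen x
  | algebraMap r => exact algebraMap r
  | add x y _ _ hx hy => exact add _ _ hx hy
  | mul x y _ _ hx hy => exact mul _ _ hx hy

variable (L) in
/-- The span of the `n`-th powers of the generators. -/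
noncomputable def symPow (n : ℕ) : Submodule ℂ (UniversalEnvelopingAlgebra ℂ L) :=
  Submodule.span ℂ {u | ∃ x ∈ genSpace L, x ^ n = u}

theorem pow_mem_symPow {u : UniversalEnvelopingAlgebra ℂ L} (hu : u ∈ genSpace L) (n : ℕ) :
    u ^ n ∈ symPow L n := Submodule.subset_span ⟨u, hu, rfl⟩

theorem symPow_one : symPow L 1 = genSpace L := by
  have : {u : UniversalEnvelopingAlgebra ℂ L | ∃ x ∈ genSpace L, x ^ 1 = u} = genSpace L := by
    ext u
    simp
  rw [symPow, this, Submodule.span_eq]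

theorem iSup_symPow : ⨆ n, symPow L n = ⊤ :=
  iSup_span_pow_eq_top _ (fun _ hx _ hy => commutator_mem_genSpace hx hy) adjoin_genSpace

/-- Two linear maps agreeing on powers of generators are equal. -/
theorem linearMap_ext_pow {M : Type*} [AddCommGroup M] [Module ℂ M]
    {f g : UniversalEnvelopingAlgebra ℂ L →ₗ[ℂ] M}
    (h : ∀ x ∈ genSpace L, ∀ n : ℕ, f (x ^ n) = g (x ^ n)) : f = g := by
  have : LinearMap.eqLocus f g = ⊤ := by
    rw [eq_top_iff, ← iSup_symPow]
    refine iSup_le fun n => Submodule.span_le.2 ?_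
    rintro _ ⟨x, hx, rfl⟩
    exact h x hx n
  exact LinearMap.eqLocus_eq_top.1 this

variable (L) in
/-- The comultiplication. -/
noncomputable def comul : UniversalEnvelopingAlgebra ℂ L →ₐ[ℂ]
    UniversalEnvelopingAlgebra ℂ L ⊗[ℂ] UniversalEnvelopingAlgebra ℂ L :=
  lift ℂ
    { toFun := fun x => ι ℂ x ⊗ₜ 1 + 1 ⊗ₜ ι ℂ x
      map_add' := fun x y => by
        rw [map_add, add_tmul, tmul_add]
        abel
      map_smul' := fun c x => by
        rw [map_smul, ← smul_tmul', tmul_smul, RingHom.id_apply, smul_add]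
      map_lie' := fun {x y} => by
        change _ = (_ * _ - _ * _ : UniversalEnvelopingAlgebra ℂ L ⊗[ℂ] _)
        rw [ι_lie]
        simp only [mul_add, add_mul, Algebra.TensorProduct.tmul_mul_tmul, one_mul, mul_one,
          sub_tmul, tmul_sub]
        abel }

theorem comul_gen {u : UniversalEnvelopingAlgebra ℂ L} (hu : u ∈ genSpace L) :
    comul L u = u ⊗ₜ 1 + 1 ⊗ₜ u := by
  obtain ⟨x, rfl⟩ := mem_genSpace.1 hu
  exact lift_ι_apply ℂ _ x

theorem comul_pow {u : UniversalEnvelopingAlgebra ℂ L} (hu : u ∈ genSpace L) (n : ℕ) :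
    comul L (u ^ n) = ∑ m ∈ Finset.range (n + 1), (n.choose m : ℂ) • ((u ^ m) ⊗ₜ[ℂ] (u ^ (n - m))) := by
  have hc : Commute (u ⊗ₜ[ℂ] (1 : UniversalEnvelopingAlgebra ℂ L)) (1 ⊗ₜ u) := by
    simp [Commute, SemiconjBy]
  rw [map_pow, comul_gen hu, hc.add_pow]
  refine Finset.sum_congr rfl fun m _ => ?_
  rw [← (Nat.cast_commute _ _).eq, ← nsmul_eq_mul, Nat.cast_smul_eq_nsmul]
  simp

variable (L) in
theorem iSupIndep_symPow : iSupIndep (symPow L) := by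
  let ψ : Module.End ℂ (UniversalEnvelopingAlgebra ℂ L) :=
    LinearMap.mul' ℂ _ ∘ₗ (comul L).toLinearMap
  have h1 := (ψ.eigenspaces_iSupIndep).comp (f := fun n : ℕ => (2 : ℂ) ^ n) (fun m n h => by
    have : (2 : ℕ) ^ m = 2 ^ n := by
      have h : (2 : ℂ) ^ m = 2 ^ n := h
      exact_mod_cast h
    exact Nat.pow_right_injective le_rfl this)
  refine h1.mono fun n => Submodule.span_le.2 ?_
  rintro _ ⟨x, hx, rfl⟩
  rw [SetLike.mem_coe, Function.comp_apply, Module.End.mem_eigenspace_iff]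
  change LinearMap.mul' ℂ _ (comul L (x ^ n)) = _
  rw [comul_pow hx, map_sum]
  have : ∀ m ∈ Finset.range (n + 1), LinearMap.mul' ℂ (UniversalEnvelopingAlgebra ℂ L)
      ((n.choose m : ℂ) • ((x ^ m) ⊗ₜ[ℂ] (x ^ (n - m)))) = (n.choose m : ℂ) • x ^ n := by
    intro m hm
    rw [map_smul, LinearMap.mul'_apply, ← pow_add, Nat.add_sub_cancel' (by simpa using hm)]
  rw [Finset.sum_congr rfl this, ← Finset.sum_smul, ← Nat.cast_sum, Nat.sum_range_choose]
  norm_num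

/-- A linear form supported in degree one. -/
def IsPrimitiveForm (ε : UniversalEnvelopingAlgebra ℂ L →ₗ[ℂ] ℂ) : Prop :=
  ∀ n ≠ 1, ∀ u ∈ symPow L n, ε u = 0

/-- Contraction of the second tensor factor of the comultiplication. -/
noncomputable def contract (ε : UniversalEnvelopingAlgebra ℂ L →ₗ[ℂ] ℂ) :
    Module.End ℂ (UniversalEnvelopingAlgebra ℂ L) :=
  (TensorProduct.rid ℂ (UniversalEnvelopingAlgebra ℂ L)).toLinearMap ∘ₗ
    LinearMap.lTensor _ ε ∘ₗ (comul L).toLinearMap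

theorem contract_pow {ε : UniversalEnvelopingAlgebra ℂ L →ₗ[ℂ] ℂ} (hε : IsPrimitiveForm ε)
    {u : UniversalEnvelopingAlgebra ℂ L} (hu : u ∈ genSpace L) (n : ℕ) :
    contract ε (u ^ n) = ((n : ℂ) * ε u) • u ^ (n - 1) := by
  change TensorProduct.rid ℂ _ (LinearMap.lTensor _ ε (comul L (u ^ n))) = _
  rw [comul_pow hu, map_sum, map_sum]
  have h1 : ∀ m, TensorProduct.rid ℂ (UniversalEnvelopingAlgebra ℂ L) (LinearMap.lTensor _ ε
      ((n.choose m : ℂ) • ((u ^ m) ⊗ₜ[ℂ] (u ^ (n - m))))) = ((n.choose m : ℂ) * ε (u ^ (n - m))) • u ^ m := by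
    intro m
    rw [map_smul, LinearMap.lTensor_tmul, map_smul, TensorProduct.rid_tmul, mul_smul]
  simp only [h1]
  rcases n with - | n
  · simpa using Or.inl (hε 0 (by simp) _ (by simpa using pow_mem_symPow hu 0))
  · rw [Finset.sum_eq_single n]
    · simp
    · intro m hm hmn
      have := Finset.mem_range.1 hm
      rw [hε (n + 1 - m) (by omega) _ (pow_mem_symPow hu _)]
      simp
    · intro h
      simp at h

theorem contract_mem_symPow {ε : UniversalEnvelopingAlgebra ℂ L →ₗ[ℂ] ℂ} (hε : IsPrimitiveForm ε)
    {n : ℕ} {u : UniversalEnvelopingAlgebra ℂ L} (hu : u ∈ symPow L (n + 1)) :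
    contract ε u ∈ symPow L n := by
  suffices h : symPow L (n + 1) ≤ (symPow L n).comap (contract ε) from h hu
  refine Submodule.span_le.2 ?_
  rintro _ ⟨x, hx, rfl⟩
  rw [SetLike.mem_coe, Submodule.mem_comap, contract_pow hε hx]
  exact Submodule.smul_mem _ _ (pow_mem_symPow hx _)

theorem contract_comm {ε δ : UniversalEnvelopingAlgebra ℂ L →ₗ[ℂ] ℂ} (hε : IsPrimitiveForm ε)
    (hδ : IsPrimitiveForm δ) (u : UniversalEnvelopingAlgebra ℂ L) :
    contract ε (contract δ u) = contract δ (contract ε u) := by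
  suffices h : contract ε ∘ₗ contract δ = contract δ ∘ₗ contract ε from LinearMap.congr_fun h u
  refine linearMap_ext_pow fun x hx n => ?_
  simp only [LinearMap.comp_apply, contract_pow hε hx, contract_pow hδ hx, map_smul, smul_smul]
  congr 1
  ring

/-- The adjoint action. -/
noncomputable def adj (y : UniversalEnvelopingAlgebra ℂ L) :
    Module.End ℂ (UniversalEnvelopingAlgebra ℂ L) :=
  LinearMap.mulLeft ℂ y - LinearMap.mulRight ℂ y

theorem adj_apply (y u : UniversalEnvelopingAlgebra ℂ L) : adj y u = y * u - u * y := rfl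

theorem adj_mem_symPow {y : UniversalEnvelopingAlgebra ℂ L} (hy : y ∈ genSpace L) {n : ℕ}
    {u : UniversalEnvelopingAlgebra ℂ L} (hu : u ∈ symPow L n) : adj y u ∈ symPow L n := by
  suffices h : symPow L n ≤ (symPow L n).comap (adj y) from h hu
  refine Submodule.span_le.2 ?_
  rintro _ ⟨x, hx, rfl⟩
  rw [SetLike.mem_coe, Submodule.mem_comap, adj_apply, mul_pow_sub_pow_mul]
  exact polarPow_mem _ _ _ _ fun t => pow_mem_symPow
    (add_mem hx (Submodule.smul_mem _ t (commutator_mem_genSpace hy hx))) n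

theorem contract_adj {ε : UniversalEnvelopingAlgebra ℂ L →ₗ[ℂ] ℂ} (hε : IsPrimitiveForm ε)
    {y : UniversalEnvelopingAlgebra ℂ L} (hy : y ∈ genSpace L)
    (hεy : ∀ x ∈ genSpace L, ε (adj y x) = 0) (u : UniversalEnvelopingAlgebra ℂ L) :
    contract ε (adj y u) = adj y (contract ε u) := by
  have h0 : ε ∘ₗ adj y = 0 := by
    refine linearMap_ext_pow fun x hx n => ?_
    rw [LinearMap.comp_apply, LinearMap.zero_apply]
    by_cases hn : n = 1
    · rw [hn, pow_one, hεy x hx]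
    · exact hε n hn _ (adj_mem_symPow hy (pow_mem_symPow hx n))
  have h1 : ∀ w : UniversalEnvelopingAlgebra ℂ L ⊗[ℂ] UniversalEnvelopingAlgebra ℂ L,
      TensorProduct.rid ℂ _ (LinearMap.lTensor _ ε ((y ⊗ₜ 1 + 1 ⊗ₜ y) * w - w * (y ⊗ₜ 1 + 1 ⊗ₜ y)))
        = adj y (TensorProduct.rid ℂ _ (LinearMap.lTensor _ ε w)) := by
    intro w
    induction w using TensorProduct.induction_on with
    | zero => simp
    | tmul a b =>
      have hb : ε (y * b) = ε (b * y) := by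
        rw [← sub_eq_zero, ← map_sub]
        exact LinearMap.congr_fun h0 b
      simp [add_mul, mul_add, hb, adj_apply, smul_sub]
    | add w w' hw hw' =>
      rw [map_add, map_add, map_add, ← hw, ← hw', ← map_add, ← map_add]
      congr 2
      noncomm_ring
  rw [contract, LinearMap.comp_apply, LinearMap.comp_apply, adj_apply]
  change TensorProduct.rid ℂ _ (LinearMap.lTensor _ ε (comul L (y * u - u * y))) = _
  rw [map_sub, map_mul, map_mul, comul_gen hy, h1]
  rfl

end UniversalEnvelopingAlgebra

/-- A basis adapted to the pair of subspaces `P`, `Q`. -/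
theorem Module.exists_basis_adapted {k V : Type*} [Field k] [AddCommGroup V] [Module k V]
    (P Q : Submodule k V) : ∃ (s : Set V) (b : Module.Basis s k V), (∀ i, b i = i) ∧
      ∀ i, b i ∈ P ∨ (b i ∈ Q ∧ P ≤ LinearMap.ker (b.coord i)) ∨
        (P ⊔ Q ≤ LinearMap.ker (b.coord i)) := by
  obtain ⟨s₀, hs₀P, hs₀, hi₀⟩ := exists_linearIndependent k (P : Set V)
  obtain ⟨s₁, hs₁, h01, hsp₁, hi₁⟩ := exists_linearIndepOn_id_extension hi₀
    (t := (P : Set V) ∪ Q) (hs₀P.trans Set.subset_union_left)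
  obtain ⟨s₂, -, h12, hsp₂, hi₂⟩ := exists_linearIndepOn_id_extension hi₁ (Set.subset_univ _)
  have htop : ⊤ ≤ Submodule.span k (Set.range ((↑) : s₂ → V)) := by
    rw [Subtype.range_coe]
    exact fun x _ => hsp₂ (Set.mem_univ x)
  let b : Module.Basis s₂ k V := Module.Basis.mk hi₂ htop
  have hb (i) : b i = i := Module.Basis.mk_apply _ _ _
  have key (t : Set V) (ht : t ⊆ s₂) (i : s₂) (hi : (i : V) ∉ t) :
      Submodule.span k t ≤ LinearMap.ker (b.coord i) := by
    refine Submodule.span_le.2 fun x hx => ?_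
    have : x = b ⟨x, ht hx⟩ := (hb ⟨x, ht hx⟩).symm
    rw [SetLike.mem_coe, LinearMap.mem_ker, this, Module.Basis.coord_apply,
      Module.Basis.repr_self, Finsupp.single_eq_of_ne]
    rintro rfl
    exact hi hx
  refine ⟨s₂, b, hb, fun i => ?_⟩
  have hP : P ≤ Submodule.span k s₀ := by
    rw [hs₀]
    exact Submodule.subset_span
  by_cases hi0 : (i : V) ∈ s₀
  · exact Or.inl (by rw [hb]; exact hs₀P hi0)
  have hPi := hP.trans (key s₀ (h01.trans h12) i hi0)
  by_cases hi1 : (i : V) ∈ s₁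
  · rcases hs₁ hi1 with h | h
    · exact Or.inl (by rwa [hb])
    · exact Or.inr (Or.inl ⟨by rwa [hb], hPi⟩)
  · refine Or.inr (Or.inr (le_trans ?_ (key s₁ h12 i hi1)))
    exact sup_le (fun x hx => hsp₁ (Or.inl hx)) (fun x hx => hsp₁ (Or.inr hx))

namespace UniversalEnvelopingAlgebra

variable {L : Type*} [LieRing L] [LieAlgebra ℂ L]

theorem exists_isPrimitiveForm (f : genSpace L →ₗ[ℂ] ℂ) :
    ∃ ε : UniversalEnvelopingAlgebra ℂ L →ₗ[ℂ] ℂ, IsPrimitiveForm ε ∧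
      ∀ u (hu : u ∈ genSpace L), ε u = f ⟨u, hu⟩ := by
  have hc : IsCompl (symPow L 1) (⨆ n ≠ 1, symPow L n) := by
    refine ⟨iSupIndep_symPow L 1, codisjoint_iff.2 ?_⟩
    rw [eq_top_iff, ← iSup_symPow]
    refine iSup_le fun n => ?_
    by_cases hn : n = 1
    · rw [hn]
      exact le_sup_left
    · exact le_sup_of_le_right (le_iSup₂_of_le n hn le_rfl)
  refine ⟨f ∘ₗ Submodule.inclusion symPow_one.le ∘ₗ Submodule.projectionOnto _ _ hc, ?_, ?_⟩
  · intro n hn u hu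
    have : Submodule.projectionOnto _ _ hc u = 0 :=
      (Submodule.projectionOnto_apply_eq_zero_iff hc).2
        ((le_iSup₂_of_le (f := fun n (_ : n ≠ 1) => symPow L n) n hn le_rfl) hu)
    simp [this]
  · intro u hu
    have := Submodule.projectionOnto_apply_left hc ⟨u, symPow_one.ge hu⟩
    simp only [LinearMap.comp_apply]
    rw [this]
    rfl

/-- The Euler identity. -/
theorem sum_contract_mul [FiniteDimensional ℂ L] {ι' : Type*} [Fintype ι']
    (b : Module.Basis ι' ℂ (genSpace L)) (ε : ι' → UniversalEnvelopingAlgebra ℂ L →ₗ[ℂ] ℂ)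
    (hε : ∀ i, IsPrimitiveForm (ε i)) (hεb : ∀ i u (hu : u ∈ genSpace L), ε i u = b.coord i ⟨u, hu⟩)
    {n : ℕ} {u : UniversalEnvelopingAlgebra ℂ L} (hu : u ∈ symPow L n) :
    ∑ i, contract (ε i) u * b i = (n : ℂ) • u := by
  suffices h : symPow L n ≤ LinearMap.eqLocus
      (∑ i, LinearMap.mulRight ℂ (b i : UniversalEnvelopingAlgebra ℂ L) ∘ₗ contract (ε i))
      ((n : ℂ) • LinearMap.id) by
    simpa using h hu
  refine Submodule.span_le.2 ?_
  rintro _ ⟨x, hx, rfl⟩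
  rw [SetLike.mem_coe, LinearMap.mem_eqLocus]
  simp only [LinearMap.coe_sum, Finset.sum_apply, LinearMap.comp_apply, contract_pow (hε _) hx,
    LinearMap.mulRight_apply, smul_mul_assoc, LinearMap.smul_apply, LinearMap.id_apply, mul_smul]
  rw [← Finset.smul_sum]
  have : ∑ i, ε i x • (b i : UniversalEnvelopingAlgebra ℂ L) = x := by
    have := congrArg (Subtype.val) (b.sum_repr ⟨x, hx⟩)
    rw [Submodule.coe_sum] at this
    simpa only [hεb _ x hx, Submodule.coe_smul, Module.Basis.coord_apply] using this
  have h2 : ∑ i, ε i x • (x ^ (n - 1) * b i) = x ^ (n - 1) * x := by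
    conv_rhs => rw [← this, Finset.mul_sum]
    simp only [mul_smul_comm, this]
  rw [h2]
  rcases n with - | n
  · simp
  · simp [pow_succ]

variable (L) in
/-- The image of `[L, r]`. -/
noncomputable def lieRadSpan : Submodule ℂ (UniversalEnvelopingAlgebra ℂ L) :=
  Submodule.span ℂ {u | ∃ x : L, ∃ y ∈ LieAlgebra.radical ℂ L, ι ℂ ⁅x, y⁆ = u}

variable (L) in
/-- The elements commuting with the radical. -/
noncomputable def radCentralizer : Submodule ℂ (UniversalEnvelopingAlgebra ℂ L) :=
  ⨅ y : LieAlgebra.radical ℂ L, LinearMap.ker (adj (ι ℂ (y : L)))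

theorem mem_radCentralizer {u : UniversalEnvelopingAlgebra ℂ L} :
    u ∈ radCentralizer L ↔ ∀ y ∈ LieAlgebra.radical ℂ L, adj (ι ℂ y) u = 0 := by
  simp [radCentralizer, Submodule.mem_iInf]

variable (L) in
/-- The left ideal generated by `[L, r]`. -/
noncomputable def lieRadIdeal : Ideal (UniversalEnvelopingAlgebra ℂ L) :=
  Ideal.span (lieRadSpan L)

theorem mul_gen_mem_lieRadIdeal {u v : UniversalEnvelopingAlgebra ℂ L} (hu : u ∈ lieRadIdeal L)
    (hv : v ∈ genSpace L) : u * v ∈ lieRadIdeal L := by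
  obtain ⟨x, rfl⟩ := mem_genSpace.1 hv
  induction hu using Submodule.span_induction with
  | zero => simp
  | add a b _ _ ha hb => rw [add_mul]; exact add_mem ha hb
  | smul a b _ hb => rw [smul_mul_assoc]; exact Ideal.mul_mem_left _ a hb
  | mem w hw =>
    induction hw using Submodule.span_induction with
    | zero => simp
    | add a b _ _ ha hb => rw [add_mul]; exact add_mem ha hb
    | smul a b _ hb =>
      rw [smul_mul_assoc, Algebra.smul_def]
      exact Ideal.mul_mem_left _ _ hb
    | mem w hw =>
      obtain ⟨z, y, hy, rfl⟩ := hw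
      have h1 : ι ℂ ⁅z, y⁆ * ι ℂ x = ι ℂ x * ι ℂ ⁅z, y⁆ - ι ℂ ⁅x, ⁅z, y⁆⁆ := by
        rw [ι_lie x]
        abel
      rw [h1]
      refine sub_mem (Ideal.mul_mem_left _ _ (Ideal.subset_span
        (Submodule.subset_span ⟨z, y, hy, rfl⟩))) (Ideal.subset_span
        (Submodule.subset_span ⟨x, _, ?_, rfl⟩))
      exact LieSubmodule.lie_mem _ hy

theorem contract_mem_radCentralizer {ε : UniversalEnvelopingAlgebra ℂ L →ₗ[ℂ] ℂ}
    (hε : IsPrimitiveForm ε) (hK : ∀ u ∈ lieRadSpan L, ε u = 0)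
    {u : UniversalEnvelopingAlgebra ℂ L} (hu : u ∈ radCentralizer L) :
    contract ε u ∈ radCentralizer L := by
  rw [mem_radCentralizer] at *
  intro y hy
  rw [← contract_adj hε (ι_mem_genSpace y), hu y hy, map_zero]
  intro x hx
  obtain ⟨x, rfl⟩ := mem_genSpace.1 hx
  rw [adj_apply, ← neg_sub, ← ι_lie, map_neg, hK _ (Submodule.subset_span ⟨x, y, hy, rfl⟩), neg_zero]

variable (L) in
/-- The generators commuting with the radical. -/
noncomputable def radCentralizerGen : Submodule ℂ (UniversalEnvelopingAlgebra ℂ L) :=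
  genSpace L ⊓ radCentralizer L

theorem lieRadSpan_le_genSpace : lieRadSpan L ≤ genSpace L := by
  refine Submodule.span_le.2 ?_
  rintro _ ⟨x, y, -, rfl⟩
  exact ι_mem_genSpace _

variable (L) in
/-- A basis of the generators adapted to `lieRadSpan` and `radCentralizerGen`, with primitive
coordinate forms. -/
theorem exists_adapted_forms [FiniteDimensional ℂ L] :
    ∃ (s : Set (genSpace L)) (_ : Fintype s) (ε : s → UniversalEnvelopingAlgebra ℂ L →ₗ[ℂ] ℂ),
      (∀ i, IsPrimitiveForm (ε i)) ∧
      (∀ n : ℕ, ∀ u ∈ symPow L n,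
        ∑ i : s, contract (ε i) u * (i : genSpace L) = (n : ℂ) • u) ∧
      ∀ i : s, ((i : genSpace L) : UniversalEnvelopingAlgebra ℂ L) ∈ lieRadSpan L ∨
        ((∀ u ∈ lieRadSpan L, ε i u = 0) ∧
          (((i : genSpace L) : UniversalEnvelopingAlgebra ℂ L) ∈ radCentralizerGen L ∨
            ∀ u ∈ radCentralizerGen L, ε i u = 0)) := by
  have : Module.Finite ℂ (genSpace L) := by
    rw [genSpace]
    infer_instance
  obtain ⟨s, b, hb, htri⟩ := Module.exists_basis_adapted ((lieRadSpan L).comap (genSpace L).subtype)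
    ((radCentralizerGen L).comap (genSpace L).subtype)
  have : Fintype s := FiniteDimensional.fintypeBasisIndex b
  choose ε hε hεb using fun i => exists_isPrimitiveForm (b.coord i)
  refine ⟨s, this, ε, hε, fun n u hu => ?_, fun i => ?_⟩
  · rw [← sum_contract_mul b ε hε hεb hu]
    simp only [hb]
  have hK (h : (lieRadSpan L).comap (genSpace L).subtype ≤ LinearMap.ker (b.coord i)) :
      ∀ u ∈ lieRadSpan L, ε i u = 0 := fun u hu => by
    rw [hεb i u (lieRadSpan_le_genSpace hu)]
    exact h (x := ⟨u, lieRadSpan_le_genSpace hu⟩) hu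
  rcases htri i with h | ⟨h, h'⟩ | h
  · rw [hb] at h
    exact Or.inl h
  · rw [hb] at h
    exact Or.inr ⟨hK h', Or.inl h⟩
  · refine Or.inr ⟨hK (le_sup_left.trans h), Or.inr fun u hu => ?_⟩
    rw [hεb i u hu.1]
    exact le_sup_right.trans h (x := ⟨u, hu.1⟩) hu

theorem contract_mem_lieRadIdeal [FiniteDimensional ℂ L] (n : ℕ) :
    ∀ u ∈ symPow L n, u ∈ radCentralizer L →
    ∀ ε : UniversalEnvelopingAlgebra ℂ L →ₗ[ℂ] ℂ, IsPrimitiveForm ε →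
      (∀ u ∈ lieRadSpan L, ε u = 0) → (∀ u ∈ radCentralizerGen L, ε u = 0) →
      contract ε u ∈ lieRadIdeal L := by
  obtain ⟨s, _, δ, hδ, heul, htri⟩ := exists_adapted_forms L
  have h0 : ∀ ε : UniversalEnvelopingAlgebra ℂ L →ₗ[ℂ] ℂ, IsPrimitiveForm ε →
      ∀ n : ℕ, ∀ u ∈ symPow L n, n = 0 → contract ε u = 0 := by
    rintro ε hε _ u hu rfl
    suffices h : symPow L 0 ≤ LinearMap.ker (contract ε) from h hu
    refine Submodule.span_le.2 ?_
    rintro _ ⟨x, hx, rfl⟩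
    rw [SetLike.mem_coe, LinearMap.mem_ker, contract_pow hε hx]
    simp
  induction n with
  | zero =>
    intro u hu _ ε hε _ _
    rw [h0 ε hε 0 u hu rfl]
    exact zero_mem _
  | succ n ih =>
    intro u hu huE ε hε hεK hεQ
    rcases n with - | n
    · have hu1 : u ∈ genSpace L := symPow_one.le hu
      have := contract_pow hε hu1 1
      rw [pow_one, hεQ u ⟨hu1, huE⟩] at this
      rw [this]
      simp
    · have h1 := heul (n + 1) _ (contract_mem_symPow hε hu)
      have h2 : (((n + 1 : ℕ) : ℂ)) ≠ 0 := Nat.cast_ne_zero.2 n.succ_ne_zero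
      have h3 : contract ε u = ((n + 1 : ℕ) : ℂ)⁻¹ • ∑ i : s, contract (δ i) (contract ε u) * (i : genSpace L) := by
        rw [h1, inv_smul_smul₀ h2]
      rw [h3, Algebra.smul_def]
      refine Ideal.mul_mem_left _ _ (sum_mem fun i _ => ?_)
      rcases htri i with h | ⟨h, -⟩
      · exact Ideal.mul_mem_left _ _ (Ideal.subset_span h)
      · rw [contract_comm (hδ i) hε]
        exact mul_gen_mem_lieRadIdeal (ih _ (contract_mem_symPow (hδ i) hu)
          (contract_mem_radCentralizer (hδ i) h huE) ε hε hεK hεQ) (i : genSpace L).2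

variable (L) in
/-- The subalgebra generated by the generators commuting with the radical. -/
noncomputable def radCentralizerAlg : Subalgebra ℂ (UniversalEnvelopingAlgebra ℂ L) :=
  Algebra.adjoin ℂ (radCentralizerGen L)

theorem symPow_inf_radCentralizer_le [FiniteDimensional ℂ L] (n : ℕ) :
    ∀ u ∈ symPow L n, u ∈ radCentralizer L →
      ∃ a ∈ radCentralizerAlg L, u - a ∈ lieRadIdeal L := by
  obtain ⟨s, _, δ, hδ, heul, htri⟩ := exists_adapted_forms L
  induction n with
  | zero =>
    intro u hu _
    refine ⟨u, ?_, by simp⟩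
    suffices h : symPow L 0 ≤ (radCentralizerAlg L).toSubmodule from h hu
    refine Submodule.span_le.2 ?_
    rintro _ ⟨x, hx, rfl⟩
    rw [pow_zero]
    exact one_mem (radCentralizerAlg L)
  | succ n ih =>
    intro u hu huE
    have h1 := heul (n + 1) _ hu
    have h2 : (((n + 1 : ℕ) : ℂ)) ≠ 0 := Nat.cast_ne_zero.2 n.succ_ne_zero
    have key : ∀ i : s, ∃ a ∈ radCentralizerAlg L,
        contract (δ i) u * (i : genSpace L) - a ∈ lieRadIdeal L := by
      intro i
      rcases htri i with h | ⟨h, h' | h'⟩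
      · refine ⟨0, zero_mem _, ?_⟩
        rw [sub_zero]
        exact Ideal.mul_mem_left _ _ (Ideal.subset_span h)
      · obtain ⟨a, ha, hau⟩ := ih _ (contract_mem_symPow (hδ i) hu)
          (contract_mem_radCentralizer (hδ i) h huE)
        refine ⟨a * (i : genSpace L), mul_mem ha (Algebra.subset_adjoin h'), ?_⟩
        rw [← sub_mul]
        exact mul_gen_mem_lieRadIdeal hau (i : genSpace L).2
      · refine ⟨0, zero_mem _, ?_⟩
        rw [sub_zero]
        exact mul_gen_mem_lieRadIdeal (contract_mem_lieRadIdeal _ u hu huE (δ i) (hδ i) h h')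
          (i : genSpace L).2
    choose a ha hau using key
    refine ⟨((n + 1 : ℕ) : ℂ)⁻¹ • ∑ i, a i,
      Subalgebra.smul_mem _ (sum_mem fun i _ => ha i) _, ?_⟩
    rw [← inv_smul_smul₀ h2 u, ← h1, ← smul_sub, ← Finset.sum_sub_distrib, Algebra.smul_def]
    exact Ideal.mul_mem_left _ _ (sum_mem fun i _ => hau i)

theorem exists_sub_mem_lieRadIdeal [FiniteDimensional ℂ L] {u : UniversalEnvelopingAlgebra ℂ L}
    (hu : u ∈ radCentralizer L) : ∃ a ∈ radCentralizerAlg L, u - a ∈ lieRadIdeal L := by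
  have htop : u ∈ ⨆ n, symPow L n := by
    rw [iSup_symPow]
    trivial
  obtain ⟨c, hc, rfl⟩ := (Submodule.mem_iSup_iff_exists_finsupp _ _).1 htop
  have hcE : ∀ n ∈ c.support, c n ∈ radCentralizer L := by
    intro n hn
    rw [mem_radCentralizer] at *
    intro y hy
    have h := hu y hy
    rw [Finsupp.sum, map_sum] at h
    exact (iSupIndep_iff_finsetSum_eq_zero_imp_eq_zero _).1 (iSupIndep_symPow L) _ _
      (fun n _ => adj_mem_symPow (ι_mem_genSpace y) (hc n)) h n hn
  choose! a ha hau using fun n (hn : n ∈ c.support) =>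
    symPow_inf_radCentralizer_le n (c n) (hc n) (hcE n hn)
  refine ⟨∑ n ∈ c.support, a n, sum_mem ha, ?_⟩
  rw [Finsupp.sum, ← Finset.sum_sub_distrib]
  exact sum_mem hau

end UniversalEnvelopingAlgebra

namespace UniversalEnvelopingAlgebra

variable {L : Type*} [LieRing L] [LieAlgebra ℂ L]

theorem adj_mul (y u v : UniversalEnvelopingAlgebra ℂ L) :
    adj y (u * v) = adj y u * v + u * adj y v := by
  simp only [adj_apply]
  noncomm_ring

theorem adj_lie (x y : L) (u : UniversalEnvelopingAlgebra ℂ L) :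
    adj (ι ℂ ⁅x, y⁆) u = adj (ι ℂ x) (adj (ι ℂ y) u) - adj (ι ℂ y) (adj (ι ℂ x) u) := by
  simp only [adj_apply, ι_lie]
  noncomm_ring

theorem adj_mem_radCentralizer (x : L) {u : UniversalEnvelopingAlgebra ℂ L}
    (hu : u ∈ radCentralizer L) : adj (ι ℂ x) u ∈ radCentralizer L := by
  rw [mem_radCentralizer] at *
  intro y hy
  have h := hu _ (LieSubmodule.lie_mem (LieAlgebra.radical ℂ L) (x := x) hy)
  rw [adj_lie, hu y hy, map_zero, zero_sub, neg_eq_zero] at h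
  exact h

theorem adj_mem_radCentralizerGen (x : L) {u : UniversalEnvelopingAlgebra ℂ L}
    (hu : u ∈ radCentralizerGen L) : adj (ι ℂ x) u ∈ radCentralizerGen L :=
  ⟨commutator_mem_genSpace (ι_mem_genSpace x) hu.1, adj_mem_radCentralizer x hu.2⟩

theorem mul_mem_radCentralizer {u v : UniversalEnvelopingAlgebra ℂ L}
    (hu : u ∈ radCentralizer L) (hv : v ∈ radCentralizer L) : u * v ∈ radCentralizer L := by
  rw [mem_radCentralizer] at *
  intro y hy
  rw [adj_mul, hu y hy, hv y hy, zero_mul, mul_zero, add_zero]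

theorem radCentralizerAlg_le {u : UniversalEnvelopingAlgebra ℂ L}
    (hu : u ∈ radCentralizerAlg L) : u ∈ radCentralizer L := by
  induction hu using Algebra.adjoin_induction with
  | mem x hx => exact hx.2
  | algebraMap r =>
    rw [mem_radCentralizer]
    intro y _
    rw [adj_apply, Algebra.commutes, sub_self]
  | add x y _ _ hx hy => exact add_mem hx hy
  | mul x y _ _ hx hy => exact mul_mem_radCentralizer hx hy

theorem commutator_mem_radCentralizerGen {u v : UniversalEnvelopingAlgebra ℂ L}
    (hu : u ∈ radCentralizerGen L) (hv : v ∈ radCentralizerGen L) :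
    u * v - v * u ∈ radCentralizerGen L :=
  ⟨commutator_mem_genSpace hu.1 hv.1,
    sub_mem (mul_mem_radCentralizer hu.2 hv.2) (mul_mem_radCentralizer hv.2 hu.2)⟩

instance [FiniteDimensional ℂ L] : Module.Finite ℂ (genSpace L) := by
  rw [genSpace]
  infer_instance

instance [FiniteDimensional ℂ L] : Module.Finite ℂ (radCentralizerGen L) :=
  Submodule.finiteDimensional_of_le (inf_le_left : radCentralizerGen L ≤ genSpace L)

instance [FiniteDimensional ℂ L] : IsNoetherianRing (radCentralizerAlg L) := by
  obtain ⟨m, f, hf⟩ := Submodule.fg_iff_exists_fin_generating_family.1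
    (Module.Finite.iff_fg.1 (inferInstance : Module.Finite ℂ (radCentralizerGen L)))
  have hfm (i) : f i ∈ radCentralizerGen L := hf ▸ Submodule.subset_span ⟨i, rfl⟩
  have hfA (i) : f i ∈ radCentralizerAlg L := Algebra.subset_adjoin (hfm i)
  have hmap : Submodule.map (radCentralizerAlg L).val.toLinearMap
      (Submodule.span ℂ (Set.range fun i => (⟨f i, hfA i⟩ : radCentralizerAlg L))) =
        radCentralizerGen L := by
    rw [Submodule.map_span, ← hf, ← Set.range_comp]
    rfl
  have hmem (u : radCentralizerAlg L) (hu : (u : UniversalEnvelopingAlgebra ℂ L) ∈ radCentralizerGen L) :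
      u ∈ Submodule.span ℂ (Set.range fun i => (⟨f i, hfA i⟩ : radCentralizerAlg L)) := by
    rw [← hmap] at hu
    obtain ⟨v, hv, hvu⟩ := hu
    rwa [← Subtype.ext hvu]
  refine isNoetherianRing_of_commutator_mem_span (k := ℂ) (fun i => ⟨f i, hfA i⟩) ?_ fun i j => ?_
  · refine eq_top_iff.2 ((Algebra.adjoin_adjoin_coe_preimage
      (R := ℂ) (s := (radCentralizerGen L : Set (UniversalEnvelopingAlgebra ℂ L)))).ge.trans
        (Algebra.adjoin_le fun u hu => ?_))
    exact Algebra.span_le_adjoin _ _ (hmem u hu)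
  · exact hmem _ (commutator_mem_radCentralizerGen (hfm i) (hfm j))

theorem adj_mem_radCentralizerAlg (x : L) {u : UniversalEnvelopingAlgebra ℂ L}
    (hu : u ∈ radCentralizerAlg L) : adj (ι ℂ x) u ∈ radCentralizerAlg L := by
  induction hu using Algebra.adjoin_induction with
  | mem u hu => exact Algebra.subset_adjoin (adj_mem_radCentralizerGen x hu)
  | algebraMap r =>
    rw [adj_apply, Algebra.commutes, sub_self]
    exact zero_mem _
  | add u v _ _ hu hv =>
    rw [map_add]
    exact add_mem hu hv
  | mul u v hu' hv' hu hv =>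
    rw [adj_mul]
    exact add_mem (mul_mem hu hv') (mul_mem hu' hv)

/-- The subalgebra is locally finite for the adjoint action. -/
theorem exists_finite_adj_stable [FiniteDimensional ℂ L] {u : UniversalEnvelopingAlgebra ℂ L}
    (hu : u ∈ radCentralizerAlg L) :
    ∃ N : Submodule ℂ (UniversalEnvelopingAlgebra ℂ L), Module.Finite ℂ N ∧ u ∈ N ∧
      ∀ x : L, ∀ v ∈ N, adj (ι ℂ x) v ∈ N := by
  set B : Submodule ℂ (UniversalEnvelopingAlgebra ℂ L) := 1 ⊔ radCentralizerGen L
  have hB1 : 1 ≤ B := le_sup_left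
  have hBfg : B.FG := Submodule.FG.sup (by rw [Submodule.one_eq_span]; exact Submodule.fg_span_singleton 1)
    (Module.Finite.iff_fg.1 inferInstance)
  have hBst : ∀ x : L, ∀ v ∈ B, adj (ι ℂ x) v ∈ B := by
    intro x v hv
    obtain ⟨a, ha, b, hb, rfl⟩ := Submodule.mem_sup.1 hv
    obtain ⟨c, rfl⟩ := Submodule.mem_one.1 ha
    rw [map_add, adj_apply, Algebra.commutes, sub_self, zero_add]
    exact Submodule.mem_sup_right (adj_mem_radCentralizerGen x hb)
  have hBn (n : ℕ) : ∀ x : L, ∀ v ∈ B ^ n, adj (ι ℂ x) v ∈ B ^ n := by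
    intro x
    induction n with
    | zero =>
      intro v hv
      obtain ⟨c, rfl⟩ := Submodule.mem_one.1 hv
      rw [adj_apply, Algebra.commutes, sub_self]
      exact zero_mem _
    | succ n ih =>
      intro v hv
      rw [pow_succ] at hv ⊢
      induction hv using Submodule.mul_induction_on' with
      | mem_mul_mem a ha b hb =>
        rw [adj_mul]
        exact add_mem (Submodule.mul_mem_mul (ih a ha) hb) (Submodule.mul_mem_mul ha (hBst x b hb))
      | add a _ b _ ha hb =>
        rw [map_add]
        exact add_mem ha hb
  obtain ⟨n, hn⟩ : ∃ n : ℕ, u ∈ B ^ n := by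
    have hmono {m n : ℕ} (h : m ≤ n) : B ^ m ≤ B ^ n := pow_le_pow_right' hB1 h
    induction hu using Algebra.adjoin_induction with
    | mem u hu => exact ⟨1, by rw [pow_one]; exact Submodule.mem_sup_right hu⟩
    | algebraMap r => exact ⟨0, Submodule.algebraMap_mem r⟩
    | add u v _ _ hu hv =>
      obtain ⟨m, hm⟩ := hu
      obtain ⟨n, hn⟩ := hv
      exact ⟨max m n, add_mem (hmono (le_max_left _ _) hm) (hmono (le_max_right _ _) hn)⟩
    | mul u v _ _ hu hv =>
      obtain ⟨m, hm⟩ := hu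
      obtain ⟨n, hn⟩ := hv
      exact ⟨m + n, by rw [pow_add]; exact Submodule.mul_mem_mul hm hn⟩
  exact ⟨B ^ n, Module.Finite.iff_fg.2 (hBfg.pow n), hn, hBn n⟩

theorem mem_center_of_adj_eq_zero {u : UniversalEnvelopingAlgebra ℂ L}
    (hu : ∀ x : L, adj (ι ℂ x) u = 0) : u ∈ Subring.center (UniversalEnvelopingAlgebra ℂ L) := by
  rw [Subring.mem_center_iff]
  intro v
  induction v using induction_on with
  | algebraMap c => exact Algebra.commutes c u
  | gen x => exact sub_eq_zero.1 (hu x)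
  | add v w hv hw => rw [add_mul, mul_add, hv, hw]
  | mul v w hv hw => rw [mul_assoc, hw, ← mul_assoc, hv, mul_assoc]

theorem adj_eq_zero_of_mem_center {u : UniversalEnvelopingAlgebra ℂ L}
    (hu : u ∈ Subring.center (UniversalEnvelopingAlgebra ℂ L))
    (y : UniversalEnvelopingAlgebra ℂ L) : adj y u = 0 :=
  sub_eq_zero.2 (Subring.mem_center_iff.1 hu y)

theorem center_le_radCentralizer {u : UniversalEnvelopingAlgebra ℂ L}
    (hu : u ∈ Subring.center (UniversalEnvelopingAlgebra ℂ L)) : u ∈ radCentralizer L :=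
  mem_radCentralizer.2 fun _ _ => adj_eq_zero_of_mem_center hu _

end UniversalEnvelopingAlgebra

namespace UniversalEnvelopingAlgebra

attribute [local instance] LieRing.ofAssociativeRing

variable {L : Type*} [LieRing L] [LieAlgebra ℂ L]

variable (L) in
/-- The adjoint action on tuples in the subalgebra. -/
noncomputable def adjTuple (s : Type*) : L →ₗ⁅ℂ⁆ Module.End ℂ (s → radCentralizerAlg L) where
  toFun x := LinearMap.pi fun i => (LinearMap.restrict (p := (radCentralizerAlg L).toSubmodule)
    (q := (radCentralizerAlg L).toSubmodule) (adj (ι ℂ x))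
    (fun _ hu => adj_mem_radCentralizerAlg x hu)) ∘ₗ LinearMap.proj i
  map_add' x y := by
    ext u i
    change adj (ι ℂ (x + y)) (u i) = adj (ι ℂ x) (u i) + adj (ι ℂ y) (u i)
    simp only [adj_apply, map_add, add_mul, mul_add]
    abel
  map_smul' c x := by
    ext u i
    change adj (ι ℂ (c • x)) (u i) = c • adj (ι ℂ x) (u i)
    simp only [adj_apply, map_smul, smul_mul_assoc, mul_smul_comm, smul_sub]
  map_lie' := fun {x y} => by
    ext u i
    exact adj_lie x y _

theorem adjTuple_apply {s : Type*} (x : L) (u : s → radCentralizerAlg L) (i : s) :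
    (adjTuple L s x u i : UniversalEnvelopingAlgebra ℂ L) = adj (ι ℂ x) (u i) := rfl

theorem exists_center_sum_eq [FiniteDimensional ℂ L] {H : Type*} [AddCommGroup H] [Module ℂ H]
    (ρ : UniversalEnvelopingAlgebra ℂ L →ₐ[ℂ] Module.End ℂ H) (θ : L → Module.End ℂ H)
    {s : Type*} [Fintype s] (φ : s → H)
    (hθ : ∀ x u i, θ x (ρ u (φ i)) = ρ (adj (ι ℂ x) u) (φ i))
    (u : s → radCentralizerAlg L) (hu : ∀ x, θ x (∑ i, ρ (u i) (φ i)) = 0) :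
    ∃ c : s → Subring.center (UniversalEnvelopingAlgebra ℂ L),
      ∑ i, ρ (c i) (φ i) = ∑ i, ρ (u i) (φ i) := by
  let T : (s → radCentralizerAlg L) →ₗ[ℂ] H :=
    { toFun := fun u => ∑ i, ρ (u i) (φ i)
      map_add' := fun u v => by simp [Finset.sum_add_distrib]
      map_smul' := fun c u => by simp [Finset.smul_sum] }
  have hT (x) (u) : T (adjTuple L s x u) = θ x (T u) := by
    change ∑ i, ρ (adjTuple L s x u i) (φ i) = θ x (∑ i, ρ (u i) (φ i))
    rw [map_sum]
    exact Finset.sum_congr rfl fun i _ => (hθ x _ i).symm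
  choose N hNfin huN hNst using fun i => exists_finite_adj_stable (u i).2
  let P : Submodule ℂ (s → radCentralizerAlg L) :=
    Submodule.pi Set.univ fun i => (N i).comap (radCentralizerAlg L).val.toLinearMap
  have hP (v) : v ∈ P ↔ ∀ i, (v i : UniversalEnvelopingAlgebra ℂ L) ∈ N i := by
    simp [P, Submodule.mem_pi]
  have hPfin : Module.Finite ℂ P := by
    let g : P →ₗ[ℂ] ((i : s) → N i) :=
      { toFun := fun v i => ⟨v.1 i, (hP v.1).1 v.2 i⟩
        map_add' := fun _ _ => rfl
        map_smul' := fun _ _ => rfl }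
    refine Module.Finite.of_injective g fun v w h => ?_
    have h (i) : (g v i : UniversalEnvelopingAlgebra ℂ L) = g w i := by rw [h]
    exact Subtype.ext (funext fun i => Subtype.ext (h i))
  have hPst : ∀ x, ∀ v ∈ P, adjTuple L s x v ∈ P := fun x v hv =>
    (hP _).2 fun i => hNst i x _ ((hP v).1 hv i)
  have : Module.Finite ℂ (P ⊓ LinearMap.ker T : Submodule ℂ (s → radCentralizerAlg L)) :=
    Submodule.finiteDimensional_of_le inf_le_left
  obtain ⟨n, hn, hun⟩ := exists_sub_apply_eq_zero (adjTuple L s) (fun y hy => by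
      ext v i
      exact mem_radCentralizer.1 (radCentralizerAlg_le (v i).2) y hy)
    (P ⊓ LinearMap.ker T) (fun x v hv => ⟨hPst x v hv.1, by
      rw [SetLike.mem_coe, LinearMap.mem_ker, hT, LinearMap.mem_ker.1 hv.2, map_zero]⟩) u
    (fun x => ⟨hPst x u ((hP u).2 huN), by
      rw [SetLike.mem_coe, LinearMap.mem_ker, hT]
      exact hu x⟩)
  refine ⟨fun i => ⟨(u - n) i, mem_center_of_adj_eq_zero fun x => ?_⟩, ?_⟩
  · rw [← adjTuple_apply, hun x]
    rfl
  · change T (u - n) = T u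
    rw [map_sub, LinearMap.mem_ker.1 hn.2, sub_zero]

end UniversalEnvelopingAlgebra

namespace UniversalEnvelopingAlgebra

variable {L : Type*} [LieRing L] [LieAlgebra ℂ L]

theorem algHom_eq_zero_of_mem_lieRadIdeal {B : Type*} [Ring B] [Algebra ℂ B]
    (f : UniversalEnvelopingAlgebra ℂ L →ₐ[ℂ] B)
    (hf : ∀ x : L, ∀ y ∈ LieAlgebra.radical ℂ L, f (ι ℂ ⁅x, y⁆) = 0)
    {u : UniversalEnvelopingAlgebra ℂ L} (hu : u ∈ lieRadIdeal L) : f u = 0 := by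
  suffices h : lieRadIdeal L ≤ RingHom.ker f from h hu
  refine Ideal.span_le.2 fun u hu => ?_
  suffices h : lieRadSpan L ≤ LinearMap.ker f.toLinearMap from h hu
  refine Submodule.span_le.2 ?_
  rintro _ ⟨x, y, hy, rfl⟩
  exact hf x y hy

theorem exists_monic_relation [FiniteDimensional ℂ L] {H : Type*} [AddCommGroup H] [Module ℂ H]
    (l ρ : UniversalEnvelopingAlgebra ℂ L →ₐ[ℂ] Module.End ℂ H) (τ : L → Module.End ℂ H)
    (hlρ : ∀ u v m, l u (ρ v m) = ρ v (l u m)) (hτl : ∀ x u m, τ x (l u m) = l u (τ x m))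
    (hτρ : ∀ x u m, τ x (ρ u m) = ρ u (τ x m))
    (hl : ∀ x : L, ∀ y ∈ LieAlgebra.radical ℂ L, l (ι ℂ ⁅x, y⁆) = 0)
    (X : Submodule ℂ H) [Module.Finite ℂ X]
    (hX : ∀ x, ∀ m ∈ X, l (ι ℂ x) m + ρ (ι ℂ x) m ∈ X) (φ₀ : H) (hφ₀X : φ₀ ∈ X)
    (hφ₀ : ∀ x, l (ι ℂ x) φ₀ + ρ (ι ℂ x) φ₀ + τ x φ₀ = 0)
    (z : Subring.center (UniversalEnvelopingAlgebra ℂ L)) :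
    ∃ p : Polynomial (Subring.center (UniversalEnvelopingAlgebra ℂ L)), p.Monic ∧
      ∑ k ∈ Finset.range (p.natDegree + 1), ρ (p.coeff k) (l ((z : UniversalEnvelopingAlgebra ℂ L) ^ k) φ₀) = 0 := by
  classical
  let _ : Module (radCentralizerAlg L) H :=
    Module.compHom H (ρ.comp (radCentralizerAlg L).val).toRingHom
  have smul_def (a : radCentralizerAlg L) (m : H) : a • m = ρ a m := rfl
  obtain ⟨t, ht⟩ := Module.Finite.iff_fg.1 (inferInstance : Module.Finite ℂ X)
  let M : Submodule (radCentralizerAlg L) H := Submodule.span _ (t : Set H)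
  have hXM : ∀ m ∈ X, m ∈ M := by
    intro m hm
    rw [← ht] at hm
    induction hm using Submodule.span_induction with
    | mem m hm => exact Submodule.subset_span hm
    | zero => exact zero_mem _
    | add m n _ _ hm hn => exact add_mem hm hn
    | smul c m _ hm =>
      have : c • m = (algebraMap ℂ (radCentralizerAlg L) c) • m := by
        rw [smul_def]
        change _ = ρ (algebraMap ℂ _ c) m
        rw [AlgHom.commutes, Module.algebraMap_end_apply]
      rw [this]
      exact M.smul_mem _ hm
  have : IsNoetherian (radCentralizerAlg L) M :=
    isNoetherian_of_fg_of_noetherian _ ⟨t, rfl⟩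
  have hlM : ∀ a ∈ radCentralizerAlg L, ∀ m ∈ M, l a m ∈ M := by
    intro a ha
    induction ha using Algebra.adjoin_induction with
    | mem q hq =>
      intro m hm
      induction hm using Submodule.span_induction with
      | mem m hm =>
        have hmX : m ∈ X := ht ▸ Submodule.subset_span hm
        obtain ⟨y, rfl⟩ := mem_genSpace.1 hq.1
        rw [← add_sub_cancel_right (l (ι ℂ y) m) (ρ (ι ℂ y) m)]
        exact sub_mem (hXM _ (hX y m hmX))
          (M.smul_mem (⟨_, Algebra.subset_adjoin hq⟩ : radCentralizerAlg L) (hXM m hmX))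
      | zero => simp
      | add m n _ _ hm hn =>
        rw [map_add]
        exact add_mem hm hn
      | smul c m _ hm =>
        rw [smul_def, hlρ]
        exact M.smul_mem c hm
    | algebraMap c =>
      intro m hm
      rw [AlgHom.commutes, ← AlgHom.commutes ρ]
      exact M.smul_mem (algebraMap ℂ (radCentralizerAlg L) c) hm
    | add a b _ _ ha hb =>
      intro m hm
      rw [map_add]
      exact add_mem (ha m hm) (hb m hm)
    | mul a b _ _ ha hb =>
      intro m hm
      rw [map_mul]
      exact ha _ (hb m hm)
  have hzM : ∀ m ∈ M, l z m ∈ M := by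
    obtain ⟨a, ha, hza⟩ := exists_sub_mem_lieRadIdeal (center_le_radCentralizer z.2)
    have := algHom_eq_zero_of_mem_lieRadIdeal l hl hza
    rw [map_sub, sub_eq_zero] at this
    rw [this]
    exact hlM a ha
  let θ (x : L) : Module.End ℂ H := l (ι ℂ x) + ρ (ι ℂ x) + τ x
  have hθ_apply (x m) : θ x m = l (ι ℂ x) m + ρ (ι ℂ x) m + τ x m := rfl
  let I : Set H := {m | m ∈ M ∧ ∀ x, θ x m = 0}
  have hzI : ∀ m ∈ I, l z m ∈ I := by
    rintro m ⟨hm, hmθ⟩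
    refine ⟨hzM m hm, fun x => ?_⟩
    have h1 : l (ι ℂ x) (l z m) = l z (l (ι ℂ x) m) := by
      rw [← Module.End.mul_apply, ← Module.End.mul_apply, ← map_mul, ← map_mul,
        Subring.mem_center_iff.1 z.2]
    rw [hθ_apply, h1, hτl, ← hlρ, ← map_add, ← map_add, ← hθ_apply, hmθ, map_zero]
  have hIfg : (Submodule.span (radCentralizerAlg L) I).FG :=
    isNoetherian_submodule.1 this _ (Submodule.span_le.2 fun m hm => hm.1)
  obtain ⟨s, hsI, hs⟩ := (Submodule.fg_span_iff_fg_span_finset_subset _).1 hIfg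
  have hθρ (x u) (i : s) : θ x (ρ u i) = ρ (adj (ι ℂ x) u) i := by
    have h := (hsI i.2).2 x
    have h1 : ρ (ι ℂ x) (ρ u i) = ρ (adj (ι ℂ x) u) i + ρ u (ρ (ι ℂ x) i) := by
      rw [← Module.End.mul_apply, ← Module.End.mul_apply, ← map_mul, ← map_mul,
        ← LinearMap.add_apply, ← map_add, adj_apply, sub_add_cancel]
    rw [hθ_apply, h1, hlρ, hτρ]
    rw [hθ_apply] at h
    have h2 := congrArg (ρ u) h
    rw [map_add, map_add, map_zero] at h2
    have h3 (a b c d : H) : b + (a + c) + d = a + (b + c + d) := by abel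
    rw [h3, h2, add_zero]
  let _ : Module (Subring.center (UniversalEnvelopingAlgebra ℂ L)) H :=
    Module.compHom H (ρ.toRingHom.comp (Subring.center _).subtype)
  have smul_def' (a : Subring.center (UniversalEnvelopingAlgebra ℂ L)) (m : H) : a • m = ρ a m := rfl
  let W : Submodule (Subring.center (UniversalEnvelopingAlgebra ℂ L)) H :=
    Submodule.span _ (s : Set H)
  have hIW : ∀ m ∈ I, m ∈ W := by
    intro m hm
    have hms : m ∈ Submodule.span (radCentralizerAlg L) (s : Set H) :=
      hs ▸ Submodule.subset_span hm
    obtain ⟨u, rfl⟩ := Submodule.mem_span_finset'.1 hms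
    obtain ⟨c, hc⟩ := exists_center_sum_eq ρ θ (fun i : s => (i : H)) hθρ u hm.2
    change ∑ i, ρ (u i) i ∈ W
    rw [← hc]
    exact sum_mem fun i _ => W.smul_mem (c i) (Submodule.subset_span i.2)
  let Λ : Module.End (Subring.center (UniversalEnvelopingAlgebra ℂ L)) H :=
    { toFun := l z
      map_add' := map_add _
      map_smul' := fun c m => hlρ z c m }
  have hΛW : ∀ m ∈ W, Λ m ∈ W := by
    intro m hm
    induction hm using Submodule.span_induction with
    | mem m hm => exact hIW _ (hzI m (hsI hm))
    | zero => simp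
    | add m n _ _ hm hn =>
      rw [map_add]
      exact add_mem hm hn
    | smul c m _ hm =>
      rw [map_smul]
      exact W.smul_mem c hm
  have : Module.Finite (Subring.center (UniversalEnvelopingAlgebra ℂ L)) W :=
    Module.Finite.iff_fg.2 ⟨s, rfl⟩
  obtain ⟨p, hp, hp0⟩ := LinearMap.exists_monic_and_aeval_eq_zero _ (Λ.restrict hΛW)
  refine ⟨p, hp, ?_⟩
  have hφW : φ₀ ∈ W := hIW _ ⟨hXM _ hφ₀X, fun x => hφ₀ x⟩
  have h := congrArg (fun f => (f ⟨φ₀, hφW⟩ : H)) hp0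
  simp only [Polynomial.aeval_eq_sum_range, LinearMap.coe_sum, Finset.sum_apply,
    Submodule.coe_sum, LinearMap.smul_apply, Submodule.coe_smul, LinearMap.zero_apply,
    Submodule.coe_zero] at h
  rw [← h]
  refine Finset.sum_congr rfl fun k _ => ?_
  rw [smul_def', map_pow]
  have (k : ℕ) : ((l z) ^ k) φ₀ = ((Λ.restrict hΛW) ^ k) ⟨φ₀, hφW⟩ := by
    induction k with
    | zero => rfl
    | succ k ih =>
      rw [pow_succ', pow_succ', Module.End.mul_apply, Module.End.mul_apply, ih]
      rfl
  rw [this]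

end UniversalEnvelopingAlgebra

namespace UniversalEnvelopingAlgebra

open MulOpposite

attribute [local instance] LieRing.ofAssociativeRing

variable {L : Type*} [LieRing L] [LieAlgebra ℂ L]

variable (L) in
/-- The antipode, as a map to the opposite algebra. -/
noncomputable def antipodeOp :
    UniversalEnvelopingAlgebra ℂ L →ₐ[ℂ] (UniversalEnvelopingAlgebra ℂ L)ᵐᵒᵖ :=
  lift ℂ
    { toFun := fun x => op (-ι ℂ x)
      map_add' := fun x y => by rw [map_add, neg_add, op_add]
      map_smul' := fun c x => by rw [map_smul, ← smul_neg, op_smul, RingHom.id_apply]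
      map_lie' := fun {x y} => by
        change _ = (_ * _ - _ * _ : (UniversalEnvelopingAlgebra ℂ L)ᵐᵒᵖ)
        rw [ι_lie, ← op_mul, ← op_mul, ← op_sub, neg_mul_neg, neg_mul_neg, neg_sub] }

theorem antipodeOp_ι (x : L) : antipodeOp L (ι ℂ x) = op (-ι ℂ x) := lift_ι_apply ℂ _ x

/-- The antipode. -/
noncomputable def antipode (u : UniversalEnvelopingAlgebra ℂ L) : UniversalEnvelopingAlgebra ℂ L :=
  unop (antipodeOp L u)

theorem antipode_ι (x : L) : antipode (ι ℂ x) = -ι ℂ x := by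
  rw [antipode, antipodeOp_ι, unop_op]

theorem antipode_mul (u v : UniversalEnvelopingAlgebra ℂ L) :
    antipode (u * v) = antipode v * antipode u := by
  rw [antipode, map_mul, unop_mul]
  rfl

theorem antipode_add (u v : UniversalEnvelopingAlgebra ℂ L) :
    antipode (u + v) = antipode u + antipode v := by
  rw [antipode, map_add, unop_add]
  rfl

theorem antipode_algebraMap (c : ℂ) :
    antipode (algebraMap ℂ (UniversalEnvelopingAlgebra ℂ L) c) = algebraMap ℂ _ c := by
  rw [antipode, AlgHom.commutes]
  rfl

theorem antipode_neg (u : UniversalEnvelopingAlgebra ℂ L) : antipode (-u) = -antipode u := by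
  rw [antipode, map_neg, unop_neg]
  rfl

theorem antipode_antipode (u : UniversalEnvelopingAlgebra ℂ L) : antipode (antipode u) = u := by
  induction u using induction_on with
  | algebraMap c => rw [antipode_algebraMap, antipode_algebraMap]
  | gen x => rw [antipode_ι, antipode_neg, antipode_ι, neg_neg]
  | add u v hu hv => rw [antipode_add, antipode_add, hu, hv]
  | mul u v hu hv => rw [antipode_mul, antipode_mul, hu, hv]

theorem antipode_mem_center {u : UniversalEnvelopingAlgebra ℂ L}
    (hu : u ∈ Subring.center (UniversalEnvelopingAlgebra ℂ L)) :
    antipode u ∈ Subring.center (UniversalEnvelopingAlgebra ℂ L) := by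
  rw [Subring.mem_center_iff] at *
  intro v
  rw [← antipode_antipode v, ← antipode_mul, ← antipode_mul, hu]

variable (L) in
/-- The antipode on the center. -/
noncomputable def centerAntipode : Subring.center (UniversalEnvelopingAlgebra ℂ L) →+*
    Subring.center (UniversalEnvelopingAlgebra ℂ L) where
  toFun z := ⟨antipode z, antipode_mem_center z.2⟩
  map_one' := Subtype.ext (by simp [antipode])
  map_zero' := Subtype.ext (by simp [antipode])
  map_add' z w := Subtype.ext (antipode_add _ _)
  map_mul' z w := by rw [mul_comm]; exact Subtype.ext (antipode_mul _ _)

theorem centerAntipode_centerAntipode (z : Subring.center (UniversalEnvelopingAlgebra ℂ L)) :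
    centerAntipode L (centerAntipode L z) = z := Subtype.ext (antipode_antipode _)

end UniversalEnvelopingAlgebra

section HomActions

variable {W A : Type*} [AddCommGroup W] [Module ℂ W] [Ring A] [Algebra ℂ A]

/-- Left multiplication on the space of linear maps into an algebra. -/
def homLeftMul : A →ₐ[ℂ] Module.End ℂ (W →ₗ[ℂ] A) where
  toFun b :=
    { toFun := fun φ => LinearMap.mulLeft ℂ b ∘ₗ φ
      map_add' := fun _ _ => LinearMap.comp_add _ _ _
      map_smul' := fun _ _ => LinearMap.comp_smul _ _ _ }
  map_one' := by ext; simp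
  map_zero' := by ext; simp
  map_mul' _ _ := by ext; simp
  map_add' _ _ := by ext; simp [add_mul]
  commutes' _ := by ext; simp [Algebra.smul_def]

/-- Right multiplication on the space of linear maps into an algebra. -/
def homRightMul : Aᵐᵒᵖ →ₐ[ℂ] Module.End ℂ (W →ₗ[ℂ] A) where
  toFun b :=
    { toFun := fun φ => LinearMap.mulRight ℂ b.unop ∘ₗ φ
      map_add' := fun _ _ => LinearMap.comp_add _ _ _
      map_smul' := fun _ _ => LinearMap.comp_smul _ _ _ }
  map_one' := by ext; simp
  map_zero' := by ext; simp
  map_mul' _ _ := by ext; simp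
  map_add' _ _ := by ext; simp [mul_add]
  commutes' c := by ext; simp [Algebra.smul_def, Algebra.commutes]

end HomActions

namespace UniversalEnvelopingAlgebra

open MulOpposite

attribute [local instance] LieRing.ofAssociativeRing

variable {L : Type*} [LieRing L] [LieAlgebra ℂ L] [FiniteDimensional ℂ L]
  {A : Type*} [Ring A] [Algebra ℂ A] (g : UniversalEnvelopingAlgebra ℂ L →ₐ[ℂ] A)

theorem exists_monic_of_adSemisimple
    (hg : AdSemisimple fun x : L => g (ι ℂ x)) (a : A)
    (z : Subring.center (UniversalEnvelopingAlgebra ℂ L)) :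
    (∃ p : Polynomial (Subring.center (UniversalEnvelopingAlgebra ℂ L)), p.Monic ∧
      ∑ k ∈ Finset.range (p.natDegree + 1),
        g z ^ k * a * g (antipode (p.coeff k : UniversalEnvelopingAlgebra ℂ L)) = 0) ∧
    (∃ p : Polynomial (Subring.center (UniversalEnvelopingAlgebra ℂ L)), p.Monic ∧
      ∑ k ∈ Finset.range (p.natDegree + 1),
        g (p.coeff k) * a * g (antipode (z : UniversalEnvelopingAlgebra ℂ L)) ^ k = 0) := by
  have hr : ∀ x : L, ∀ y ∈ LieAlgebra.radical ℂ L, g (ι ℂ ⁅x, y⁆) = 0 := fun x y hy =>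
    AdSemisimple.map_lie_radical ((g : UniversalEnvelopingAlgebra ℂ L →ₗ⁅ℂ⁆ A).comp (ι ℂ)) hg x hy
  obtain ⟨F, hF, haF, hst, -⟩ := hg a
  let l : UniversalEnvelopingAlgebra ℂ L →ₐ[ℂ] Module.End ℂ (F →ₗ[ℂ] A) := homLeftMul.comp g
  let ρ : UniversalEnvelopingAlgebra ℂ L →ₐ[ℂ] Module.End ℂ (F →ₗ[ℂ] A) :=
    homRightMul.comp ((AlgHom.op g).comp (antipodeOp L))
  have hl (u) (φ : F →ₗ[ℂ] A) (w : F) : l u φ w = g u * φ w := rfl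
  have hρ (u) (φ : F →ₗ[ℂ] A) (w : F) : ρ u φ w = φ w * g (antipode u) := rfl
  let d (x : L) : Module.End ℂ F := LinearMap.restrict
    (LinearMap.mulLeft ℂ (g (ι ℂ x)) - LinearMap.mulRight ℂ (g (ι ℂ x))) (hst x)
  let τ (x : L) : Module.End ℂ (F →ₗ[ℂ] A) := -LinearMap.lcomp ℂ A (d x)
  have hτ (x) (φ : F →ₗ[ℂ] A) (w : F) : τ x φ w = -φ (d x w) := rfl
  let X : Submodule ℂ (F →ₗ[ℂ] A) := 
    LinearMap.range (LinearMap.compRight ℂ F.subtype : (F →ₗ[ℂ] F) →ₗ[ℂ] F →ₗ[ℂ] A)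
  have hXF (φ) (hφ : ∀ w, φ w ∈ F) : φ ∈ X := ⟨LinearMap.codRestrict F φ hφ, rfl⟩
  have hX : ∀ x, ∀ φ ∈ X, l (ι ℂ x) φ + ρ (ι ℂ x) φ ∈ X := by
    rintro x _ ⟨φ, rfl⟩
    refine hXF _ fun w => ?_
    change g (ι ℂ x) * φ w + φ w * g (antipode (ι ℂ x)) ∈ F
    rw [antipode_ι, map_neg, mul_neg, ← sub_eq_add_neg]
    exact hst x _ (φ w).2
  have h0 : ∀ x, l (ι ℂ x) F.subtype + ρ (ι ℂ x) F.subtype + τ x F.subtype = 0 := by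
    intro x
    ext w
    change g (ι ℂ x) * w + w * g (antipode (ι ℂ x)) + -(g (ι ℂ x) * w - w * g (ι ℂ x)) = 0
    rw [antipode_ι, map_neg]
    noncomm_ring
  have h0X : F.subtype ∈ X := hXF _ fun w => w.2
  have hlρ : ∀ u v m, l u (ρ v m) = ρ v (l u m) := fun u v φ => by
    ext w
    rw [hl, hρ, hρ, hl, mul_assoc]
  have hτl : ∀ x u m, τ x (l u m) = l u (τ x m) := fun x u φ => by
    ext w
    rw [hl, hτ, hτ, hl, mul_neg]
  have hτρ : ∀ x u m, τ x (ρ u m) = ρ u (τ x m) := fun x u φ => by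
    ext w
    rw [hρ, hτ, hτ, hρ, neg_mul]
  constructor
  · obtain ⟨p, hp, h⟩ := exists_monic_relation l ρ τ hlρ hτl hτρ
      (fun x y hy => by ext φ w; rw [hl, hr x y hy, zero_mul]; rfl) X hX F.subtype h0X h0 z
    refine ⟨p, hp, ?_⟩
    have := congrArg (fun f => f ⟨a, haF⟩) h
    simp only [LinearMap.sum_apply, hl, hρ] at this
    simpa using this
  · obtain ⟨p, hp, h⟩ := exists_monic_relation ρ l τ (fun u v m => (hlρ v u m).symm) hτρ hτl
      (fun x y hy => by
        ext φ w
        rw [hρ, antipode_ι, map_neg, hr x y hy, neg_zero, mul_zero]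
        rfl) X (fun x m hm => by rw [add_comm]; exact hX x m hm) F.subtype h0X
      (fun x => by rw [add_comm (ρ _ _)]; exact h0 x) z
    refine ⟨p, hp, ?_⟩
    have := congrArg (fun f => f ⟨a, haF⟩) h
    have hpow (k : ℕ) : antipode ((z : UniversalEnvelopingAlgebra ℂ L) ^ k) = antipode z ^ k := by
      rw [antipode, map_pow, unop_pow]
      rfl
    simp only [LinearMap.sum_apply, hl, hρ, hpow] at this
    simpa [mul_assoc] using this

end UniversalEnvelopingAlgebra

theorem ringKrullDim_quotient_le_of_ideal {Z T : Type*} [CommRing Z] [CommRing T] (J : Ideal T)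
    (I I' : Ideal Z) (σ : Z →+* Z) (il ir : Z →+* T)
    (hT : ∀ t : T, t ∈ AddSubmonoid.closure (Set.range fun x : Z × Z => il x.1 * ir x.2))
    (hl : ∀ z : Z, ∃ p : Polynomial Z, p.Monic ∧
      ∑ k ∈ Finset.range (p.natDegree + 1), il (z ^ k) * ir (σ (p.coeff k)) ∈ J)
    (hr : ∀ z : Z, ∃ p : Polynomial Z, p.Monic ∧
      ∑ k ∈ Finset.range (p.natDegree + 1), il (p.coeff k) * ir (z ^ k) ∈ J)
    (hI : ∀ z ∈ I, ir z ∈ J) (hI' : ∀ z : Z, il z ∈ J → z ∈ I') :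
    ringKrullDim (Z ⧸ I') ≤ ringKrullDim (Z ⧸ I) := by
  let fl : Z →+* T ⧸ J := (Ideal.Quotient.mk J).comp il
  let fr : Z →+* T ⧸ J := (Ideal.Quotient.mk J).comp ir
  have hflr (z w : Z) : Ideal.Quotient.mk J (il z * ir w) = fl z * fr w := map_mul _ _ _
  have hfrI (z : Z) : fr.IsIntegralElem (fl z) := by
    obtain ⟨p, hp, h⟩ := hl z
    refine ⟨p.map σ, hp.map _, ?_⟩
    rw [Polynomial.eval₂_map, Polynomial.eval₂_eq_sum_range,
      ← Ideal.Quotient.eq_zero_iff_mem.2 h, map_sum]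
    refine Finset.sum_congr rfl fun k _ => ?_
    rw [hflr, map_pow, RingHom.comp_apply, mul_comm]
  have hflI (z : Z) : fl.IsIntegralElem (fr z) := by
    obtain ⟨p, hp, h⟩ := hr z
    refine ⟨p, hp, ?_⟩
    rw [Polynomial.eval₂_eq_sum_range, ← Ideal.Quotient.eq_zero_iff_mem.2 h, map_sum]
    refine Finset.sum_congr rfl fun k _ => ?_
    rw [hflr, map_pow]
  have hspan (f : Z →+* T ⧸ J) (h1 : ∀ z, f.IsIntegralElem (fl z))
      (h2 : ∀ z, f.IsIntegralElem (fr z)) : f.IsIntegral := by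
    intro x
    obtain ⟨t, rfl⟩ := Ideal.Quotient.mk_surjective x
    induction hT t using AddSubmonoid.closure_induction with
    | mem t ht =>
      obtain ⟨x, rfl⟩ := ht
      exact (h1 x.1).mul f (h2 x.2)
    | zero =>
      rw [map_zero]
      exact f.isIntegralElem_zero
    | add c d _ _ hc hd =>
      rw [map_add]
      exact hc.add f hd
  have hfr : fr.IsIntegral := hspan fr hfrI fun z => fr.isIntegralElem_map
  have hfl : fl.IsIntegral := hspan fl (fun z => fl.isIntegralElem_map) hflI
  have hIr : ∀ z ∈ I, fr z = 0 := fun z hz => Ideal.Quotient.eq_zero_iff_mem.2 (hI z hz)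
  calc ringKrullDim (Z ⧸ I') ≤ ringKrullDim (Z ⧸ RingHom.ker fl) :=
        ringKrullDim_quotient_le_of_le fun z hz => hI' z (Ideal.Quotient.eq_zero_iff_mem.1 hz)
    _ ≤ ringKrullDim (T ⧸ J) :=
        ringKrullDim_le_of_isIntegral_of_injective (RingHom.kerLift fl) hfl.kerLift
          (RingHom.kerLift_injective fl)
    _ ≤ ringKrullDim (Z ⧸ I) :=
        ringKrullDim_le_of_isIntegral (Ideal.Quotient.lift I fr hIr)
          (RingHom.IsIntegral.tower_top (Ideal.Quotient.mk I) (Ideal.Quotient.lift I fr hIr)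
            (by rwa [Ideal.Quotient.lift_comp_mk]))

namespace UniversalEnvelopingAlgebra

open TensorProduct

variable {L : Type*} [LieRing L] [LieAlgebra ℂ L]
  {A : Type*} [Ring A] [Algebra ℂ A] (g : UniversalEnvelopingAlgebra ℂ L →ₐ[ℂ] A)

/-- The action of the tensor square of the center on `A` by left and right multiplication. -/
noncomputable def centerBimul :
    Subring.center (UniversalEnvelopingAlgebra ℂ L) ⊗[ℤ]
      Subring.center (UniversalEnvelopingAlgebra ℂ L) →ₐ[ℤ] Module.End ℤ A :=
  Algebra.TensorProduct.lift
    (RingHom.toIntAlgHom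
      { toFun := fun z => LinearMap.mulLeft ℤ (g z)
        map_one' := by ext; simp
        map_zero' := by ext; simp
        map_mul' := fun _ _ => by ext; simp
        map_add' := fun _ _ => by ext; simp [add_mul] })
    (RingHom.toIntAlgHom
      { toFun := fun z => LinearMap.mulRight ℤ (g z)
        map_one' := by ext; simp
        map_zero' := by ext; simp
        map_mul' := fun z w => by
          rw [mul_comm z w]
          ext
          simp [mul_assoc]
        map_add' := fun _ _ => by ext; simp [mul_add] })
    fun _ _ => by
      ext
      simp [mul_assoc]

theorem centerBimul_tmul (z w : Subring.center (UniversalEnvelopingAlgebra ℂ L)) (b : A) :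
    centerBimul g (z ⊗ₜ w) b = g z * b * g w := by
  exact (congrArg (fun e : Module.End ℤ A => e b)
    (Algebra.TensorProduct.lift_tmul _ _ _ z w)).trans (mul_assoc _ _ _).symm

theorem centerBimul_mem (I : Ideal (Subring.center (UniversalEnvelopingAlgebra ℂ L)))
    (c : Subring.center (UniversalEnvelopingAlgebra ℂ L) ⊗[ℤ]
      Subring.center (UniversalEnvelopingAlgebra ℂ L)) {b : A}
    (hb : b ∈ Ideal.span ((fun z : Subring.center (UniversalEnvelopingAlgebra ℂ L) => g z) '' I)) :
    centerBimul g c b ∈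
      Ideal.span ((fun z : Subring.center (UniversalEnvelopingAlgebra ℂ L) => g z) '' I) := by
  induction c using TensorProduct.induction_on with
  | zero =>
    rw [map_zero]
    exact zero_mem _
  | add c d hc hd =>
    rw [map_add]
    exact add_mem hc hd
  | tmul z w =>
    rw [centerBimul_tmul, mul_assoc]
    refine Ideal.mul_mem_left _ _ ?_
    induction hb using Submodule.span_induction with
    | zero => simp
    | add b c _ _ hb hc =>
      rw [add_mul]
      exact add_mem hb hc
    | smul b c _ hc =>
      rw [smul_mul_assoc]
      exact Ideal.mul_mem_left _ _ hc
    | mem b hb =>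
      obtain ⟨i, hi, rfl⟩ := hb
      have : g i * g w = g w * g i := by
        rw [← map_mul, ← map_mul, Subring.mem_center_iff.1 w.2]
      rw [this]
      exact Ideal.mul_mem_left _ _ (Ideal.subset_span ⟨i, hi, rfl⟩)

theorem ringKrullDim_quotient_le_of_adSemisimple [FiniteDimensional ℂ L]
    (hg : AdSemisimple fun x : L => g (ι ℂ x)) {V : Type*} [AddCommGroup V] [Module A V]
    (v : V) (a : A) (I I' : Ideal (Subring.center (UniversalEnvelopingAlgebra ℂ L)))
    (hI : ∀ z ∈ I, g z • v = 0)
    (hI' : ∀ z : Subring.center (UniversalEnvelopingAlgebra ℂ L), g z • a • v = 0 → z ∈ I') :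
    ringKrullDim (Subring.center (UniversalEnvelopingAlgebra ℂ L) ⧸ I') ≤
      ringKrullDim (Subring.center (UniversalEnvelopingAlgebra ℂ L) ⧸ I) := by
  let N : Ideal A :=
    Ideal.span ((fun z : Subring.center (UniversalEnvelopingAlgebra ℂ L) => g z) '' I)
  have hN : ∀ b ∈ N, b • v = 0 := by
    suffices h : N ≤ LinearMap.ker (LinearMap.toSpanSingleton A V v) from fun b hb => h hb
    refine Ideal.span_le.2 ?_
    rintro _ ⟨z, hz, rfl⟩
    exact hI z hz
  let J : Ideal (Subring.center (UniversalEnvelopingAlgebra ℂ L) ⊗[ℤ]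
      Subring.center (UniversalEnvelopingAlgebra ℂ L)) :=
    { carrier := {c | centerBimul g c a ∈ N}
      zero_mem' := by
        change centerBimul g 0 a ∈ N
        rw [map_zero]
        exact zero_mem _
      add_mem' := fun {c d} hc hd => by
        change centerBimul g (c + d) a ∈ N
        rw [map_add]
        exact add_mem hc hd
      smul_mem' := fun c d hd => by
        change centerBimul g (c * d) a ∈ N
        rw [map_mul]
        exact centerBimul_mem g I c hd }
  have hJ (c) : c ∈ J ↔ centerBimul g c a ∈ N := Iff.rfl
  let il : Subring.center (UniversalEnvelopingAlgebra ℂ L) →+*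
      Subring.center (UniversalEnvelopingAlgebra ℂ L) ⊗[ℤ]
        Subring.center (UniversalEnvelopingAlgebra ℂ L) :=
    Algebra.TensorProduct.includeLeftRingHom
  let ir : Subring.center (UniversalEnvelopingAlgebra ℂ L) →+*
      Subring.center (UniversalEnvelopingAlgebra ℂ L) ⊗[ℤ]
        Subring.center (UniversalEnvelopingAlgebra ℂ L) :=
    (Algebra.TensorProduct.includeRight (R := ℤ)).toRingHom
  have hlr (z w) : il z * ir w = z ⊗ₜ w := by
    change z ⊗ₜ 1 * 1 ⊗ₜ w = _
    rw [Algebra.TensorProduct.tmul_mul_tmul, mul_one, one_mul]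
  have hsum (n : ℕ) (z w : ℕ → Subring.center (UniversalEnvelopingAlgebra ℂ L))
      (h : ∑ k ∈ Finset.range n, g (z k) * a * g (w k) = 0) :
      ∑ k ∈ Finset.range n, il (z k) * ir (w k) ∈ J := by
    rw [hJ, map_sum, LinearMap.sum_apply]
    simp only [hlr, centerBimul_tmul]
    rw [h]
    exact zero_mem _
  refine ringKrullDim_quotient_le_of_ideal J I I' (centerAntipode L) il ir (fun t => ?_)
    (fun z => ?_) (fun z => ?_) (fun z hz => ?_) fun z hz => ?_
  · induction t using TensorProduct.induction_on with
    | zero => exact zero_mem _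
    | tmul z w => exact AddSubmonoid.subset_closure ⟨(z, w), hlr z w⟩
    | add c d hc hd => exact add_mem hc hd
  · obtain ⟨p, hp, h⟩ := (exists_monic_of_adSemisimple g hg a z).1
    refine ⟨p, hp, hsum _ (fun k => z ^ k) (fun k => centerAntipode L (p.coeff k)) ?_⟩
    rw [← h]
    refine Finset.sum_congr rfl fun k _ => ?_
    rw [Subring.coe_pow, map_pow]
    rfl
  · obtain ⟨p, hp, h⟩ := (exists_monic_of_adSemisimple g hg a (centerAntipode L z)).2
    refine ⟨p, hp, hsum _ (fun k => p.coeff k) (fun k => z ^ k) ?_⟩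
    rw [← h]
    refine Finset.sum_congr rfl fun k _ => ?_
    rw [Subring.coe_pow, map_pow]
    congr 3
    exact (congrArg Subtype.val (centerAntipode_centerAntipode z)).symm
  · rw [← one_mul (ir z), ← map_one il, hlr, hJ, centerBimul_tmul]
    exact Ideal.mul_mem_left _ _ (Ideal.subset_span ⟨z, hz, rfl⟩)
  · rw [← mul_one (il z), ← map_one ir, hlr, hJ, centerBimul_tmul, Subring.coe_one, map_one, mul_one] at hz
    refine hI' z ?_
    rw [← mul_smul]
    exact hN _ hz

end UniversalEnvelopingAlgebra

theorem ringKrullDim_centerAnnVec_add_le {L : Type*} [LieRing L] [LieAlgebra ℂ L]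
    {A : Type*} [Ring A] [Algebra ℂ A] (g : UniversalEnvelopingAlgebra ℂ L →ₐ[ℂ] A)
    {V : Type*} [AddCommGroup V] [Module A V] {k : WithBot ℕ∞} {v w : V}
    (hv : ringKrullDim
      (Subring.center (UniversalEnvelopingAlgebra ℂ L) ⧸ centerAnnVec L A g V v) ≤ k)
    (hw : ringKrullDim
      (Subring.center (UniversalEnvelopingAlgebra ℂ L) ⧸ centerAnnVec L A g V w) ≤ k) :
    ringKrullDim
      (Subring.center (UniversalEnvelopingAlgebra ℂ L) ⧸ centerAnnVec L A g V (v + w)) ≤ k := by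
  refine (ringKrullDim_quotient_le_of_le (I := centerAnnVec L A g V v ⊓ centerAnnVec L A g V w)
    ?_).trans (ringKrullDim_quotient_inf_le hv hw)
  rintro z ⟨h1, h2⟩
  change g z • v = 0 at h1
  change g z • w = 0 at h2
  change g z • (v + w) = 0
  rw [smul_add, h1, h2, add_zero]

/-- Theorem `RankFiltration`, the equi-rank theorem.
Let `(A, G)` be a generalized pair: `A` a `ℂ`-algebra with an algebra map
`ι : U(g) → A` whose adjoint `g`-action on `A` is locally finite and completely
reducible (every element of `A` lies in a finite-dimensional `ad`-stable subspace all
of whose `ad`-stable subspaces have `ad`-stable complements).  Let `V` be an `A`-module.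
Then each rank-filtration piece `R_k(V) = {v | dim V(Ann_{Z(g)}(v)) ≤ k}` is an
`A`-submodule of `V`; consequently, if `V` is an irreducible `A`-module then `V` is
equi-rank: `dim V(Ann_{Z(g)}(v))` is the same for all `0 ≠ v ∈ V`. -/
theorem rank_filtration_A_submodule_and_irreducible_equiRank
    (L : Type*) [LieRing L] [LieAlgebra ℂ L] [FiniteDimensional ℂ L]
    (A : Type*) [Ring A] [Algebra ℂ A]
    (ι : UniversalEnvelopingAlgebra ℂ L →ₐ[ℂ] A)
    (hadj : ∀ a : A, ∃ Fm : Submodule ℂ A, FiniteDimensional ℂ Fm ∧ a ∈ Fm ∧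
      (∀ X : L, ∀ b ∈ Fm, ι (UniversalEnvelopingAlgebra.ι ℂ X) * b
        - b * ι (UniversalEnvelopingAlgebra.ι ℂ X) ∈ Fm) ∧
      (∀ S : Submodule ℂ A, S ≤ Fm →
        (∀ X : L, ∀ b ∈ S, ι (UniversalEnvelopingAlgebra.ι ℂ X) * b
          - b * ι (UniversalEnvelopingAlgebra.ι ℂ X) ∈ S) →
        ∃ S' : Submodule ℂ A, S' ≤ Fm ∧
          (∀ X : L, ∀ b ∈ S', ι (UniversalEnvelopingAlgebra.ι ℂ X) * b
            - b * ι (UniversalEnvelopingAlgebra.ι ℂ X) ∈ S') ∧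
          S ⊓ S' = ⊥ ∧ S ⊔ S' = Fm))
    (V : Type*) [AddCommGroup V] [Module ℂ V] [Module A V] [IsScalarTower ℂ A V] :
    (∀ k : WithBot ℕ∞, ∃ N : Submodule A V, ∀ v : V,
      v ∈ N ↔ ringKrullDim
        (Subring.center (UniversalEnvelopingAlgebra ℂ L) ⧸ centerAnnVec L A ι V v)
        ≤ k) ∧
    ((Nontrivial V ∧ ∀ N : Submodule A V, N = ⊥ ∨ N = ⊤) →
      ∃ d : WithBot ℕ∞, ∀ v : V, v ≠ 0 →
        ringKrullDim
          (Subring.center (UniversalEnvelopingAlgebra ℂ L) ⧸ centerAnnVec L A ι V v)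
          = d) := by
  have hR : ∀ k : WithBot ℕ∞, ∃ N : Submodule A V, ∀ v : V, v ∈ N ↔ ringKrullDim
      (Subring.center (UniversalEnvelopingAlgebra ℂ L) ⧸ centerAnnVec L A ι V v) ≤ k := by
    intro k
    refine ⟨{ carrier := {v | ringKrullDim
                (Subring.center (UniversalEnvelopingAlgebra ℂ L) ⧸ centerAnnVec L A ι V v) ≤ k}
              zero_mem' := ?_
              add_mem' := fun hv hw => ringKrullDim_centerAnnVec_add_le ι hv hw
              smul_mem' := fun a v hv => le_trans
                (ringKrullDim_quotient_le_of_adSemisimple ι hadj v a (centerAnnVec L A ι V v)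
                  (centerAnnVec L A ι V (a • v)) (fun _ h => h) fun _ h => h) hv }, fun _ => Iff.rfl⟩
    have h : centerAnnVec L A ι V 0 = ⊤ := (Ideal.eq_top_iff_one _).2 (smul_zero _)
    have : Subsingleton
        (Subring.center (UniversalEnvelopingAlgebra ℂ L) ⧸ centerAnnVec L A ι V 0) :=
      Ideal.Quotient.subsingleton_iff.2 h
    change ringKrullDim _ ≤ k
    rw [ringKrullDim_eq_bot_of_subsingleton]
    exact bot_le
  refine ⟨hR, ?_⟩
  rintro ⟨_, hirr⟩
  have hle (v w : V) (hv : v ≠ 0) :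
      ringKrullDim
        (Subring.center (UniversalEnvelopingAlgebra ℂ L) ⧸ centerAnnVec L A ι V w) ≤
      ringKrullDim
        (Subring.center (UniversalEnvelopingAlgebra ℂ L) ⧸ centerAnnVec L A ι V v) := by
    obtain ⟨N, hN⟩ := hR (ringKrullDim
      (Subring.center (UniversalEnvelopingAlgebra ℂ L) ⧸ centerAnnVec L A ι V v))
    rw [← hN]
    obtain rfl | rfl := hirr N
    · exact absurd ((hN v).2 le_rfl) hv
    · trivial
  obtain ⟨v₀, hv₀⟩ := exists_ne (0 : V)
  exact ⟨_, fun v hv => le_antisymm (hle v₀ v hv₀) (hle v v₀ hv)⟩
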